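/- arXiv:math/0310085 — 2 statements merged into one kernel-verified Lean document; each statement's English description precedes it below -/
import Mathlib

section
/- Let g ≥ 1, let τ be an element of the Siegel upper half-space H_g, let i, j ∈ {1,…,g}, and let α, ε, β ∈ {0,1}^g ⊂ ℤ^g be such that both [α,β] and [α+ε,β] are even characteristics (i.e. α·β and (α+ε)·β are even integers). Then A^β_{ij,(α+ε)α}(τ) = 2^{1−g} Σ_{σ} (−1)^{α·σ} C^β_{ij,εσ}(τ), where the sum ranges over those σ ∈ {0,1}^g ⊂ ℤ^g for which ε·σ is odd, and sums of characteristics such as α+ε are literal sums of integer vectors. -/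
open scoped BigOperators
open Complex

noncomputable section

/-- The Siegel upper half-space condition: a complex symmetric `g × g` matrix
whose imaginary part is positive definite. -/
def IsSiegel {g : ℕ} (τ : Matrix (Fin g) (Fin g) ℂ) : Prop :=
  τ.IsSymm ∧ Matrix.PosDef (Matrix.of fun i j => (τ i j).im)

/-- The theta function with characteristic `[ε, δ]`:
`θ[ε,δ](τ,z) = Σ_{m ∈ ℤ^g} exp(πi((m+ε/2)ᵀτ(m+ε/2) + 2(m+ε/2)·(z+δ/2)))`. -/
def theta {g : ℕ} (τ : Matrix (Fin g) (Fin g) ℂ) (ε δ : Fin g → ℤ)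
    (z : Fin g → ℂ) : ℂ :=
  ∑' m : Fin g → ℤ,
    Complex.exp (↑Real.pi * Complex.I *
      ((∑ i, ∑ j, ((m i : ℂ) + (ε i : ℂ) / 2) * τ i j * ((m j : ℂ) + (ε j : ℂ) / 2)) +
        2 * ∑ i, ((m i : ℂ) + (ε i : ℂ) / 2) * (z i + (δ i : ℂ) / 2)))

/-- Partial derivative `∂_{z_i} f` evaluated at `z`. -/
def dz {g : ℕ} (f : (Fin g → ℂ) → ℂ) (i : Fin g) (z : Fin g → ℂ) : ℂ :=
  fderiv ℂ f z (Pi.single i 1)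

/-- Second partial derivative `∂_{z_i}∂_{z_j} f` evaluated at `z = 0`. -/
def D2 {g : ℕ} (f : (Fin g → ℂ) → ℂ) (i j : Fin g) : ℂ :=
  fderiv ℂ (fun z => fderiv ℂ f z (Pi.single j 1)) 0 (Pi.single i 1)

/-- `A^β_{ij,εδ}(τ) = ∂_{z_i}∂_{z_j}(θ[δ,β](2τ,2z))|₀ · θ[ε,β](2τ,0)
      − θ[δ,β](2τ,0) · ∂_{z_i}∂_{z_j}(θ[ε,β](2τ,2z))|₀`. -/
def Acoef {g : ℕ} (τ : Matrix (Fin g) (Fin g) ℂ) (i j : Fin g)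
    (ε δ β : Fin g → ℤ) : ℂ :=
  D2 (fun z => theta ((2 : ℂ) • τ) δ β (fun k => 2 * z k)) i j * theta ((2 : ℂ) • τ) ε β 0 -
    theta ((2 : ℂ) • τ) δ β 0 * D2 (fun z => theta ((2 : ℂ) • τ) ε β (fun k => 2 * z k)) i j

/-- `C^β_{ij,εδ}(τ) = ∂_{z_i}θ[ε,β+δ](τ,0)·∂_{z_j}θ[ε,δ](τ,0)
      + ∂_{z_j}θ[ε,β+δ](τ,0)·∂_{z_i}θ[ε,δ](τ,0)`. -/
def Ccoef {g : ℕ} (τ : Matrix (Fin g) (Fin g) ℂ) (i j : Fin g)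
    (ε δ β : Fin g → ℤ) : ℂ :=
  dz (theta τ ε (β + δ)) i 0 * dz (theta τ ε δ) j 0 +
    dz (theta τ ε (β + δ)) j 0 * dz (theta τ ε δ) i 0

section ExponentialSeries

variable {ι E : Type*} [NormedAddCommGroup E] [NormedSpace ℂ E]

/-- The coefficients `c` decay faster than every exponential in the norms of the functionals `ℓ`. -/
def ExpDecay (c : ι → ℂ) (ℓ : ι → E →L[ℂ] ℂ) : Prop :=
  ∀ R : ℝ, Summable fun m => ‖c m‖ * Real.exp (R * ‖ℓ m‖)

theorem ExpDecay.summable_norm {c : ι → ℂ} {ℓ : ι → E →L[ℂ] ℂ} (h : ExpDecay c ℓ) :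
    Summable fun m => ‖c m‖ := by
  simpa using h 0

theorem ExpDecay.mul_norm_le {c d : ι → ℂ} {ℓ : ι → E →L[ℂ] ℂ} (h : ExpDecay c ℓ)
    (K : ℝ) (hd : ∀ m, ‖d m‖ ≤ K * ‖ℓ m‖) : ExpDecay (fun m => c m * d m) ℓ := by
  intro R
  refine Summable.of_nonneg_of_le (fun m => by positivity) (fun m => ?_)
    ((h (R + 1)).mul_left |K|)
  have h₁ : ‖d m‖ ≤ |K| * Real.exp ‖ℓ m‖ :=
    (hd m).trans (mul_le_mul (le_abs_self K)
      (by linarith [Real.add_one_le_exp ‖ℓ m‖]) (norm_nonneg _) (abs_nonneg _))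
  rw [norm_mul, add_mul, one_mul, Real.exp_add]
  calc ‖c m‖ * ‖d m‖ * Real.exp (R * ‖ℓ m‖)
      ≤ ‖c m‖ * (|K| * Real.exp ‖ℓ m‖) * Real.exp (R * ‖ℓ m‖) := by gcongr
    _ = _ := by ring

theorem ExpDecay.mul_apply {c : ι → ℂ} {ℓ : ι → E →L[ℂ] ℂ} (h : ExpDecay c ℓ) (v : E) :
    ExpDecay (fun m => c m * ℓ m v) ℓ :=
  h.mul_norm_le ‖v‖ fun m => by simpa [mul_comm] using (ℓ m).le_opNorm v

/-- A rapidly decaying exponential series may be differentiated term by term. -/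
theorem ExpDecay.fderiv_tsum_apply {c : ι → ℂ} {ℓ : ι → E →L[ℂ] ℂ} (h : ExpDecay c ℓ)
    (z v : E) :
    fderiv ℂ (fun z => ∑' m, c m * exp (ℓ m z)) z v = ∑' m, c m * ℓ m v * exp (ℓ m z) := by
  have bound : ∀ m, ∀ x ∈ Metric.ball (0 : E) (‖z‖ + 1),
      ‖exp (ℓ m x)‖ ≤ Real.exp ((‖z‖ + 1) * ‖ℓ m‖) := by
    intro m x hx
    rw [Complex.norm_exp]
    refine Real.exp_le_exp.2 ((Complex.re_le_norm _).trans (((ℓ m).le_opNorm x).trans ?_))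
    rw [mul_comm]
    gcongr
    exact (mem_ball_zero_iff.1 hx).le
  have key := h (‖z‖ + 2)
  have bound' : ∀ m, ∀ x ∈ Metric.ball (0 : E) (‖z‖ + 1),
      ‖(c m * exp (ℓ m x)) • ℓ m‖ ≤ ‖c m‖ * Real.exp ((‖z‖ + 2) * ‖ℓ m‖) := by
    intro m x hx
    have h₁ : ‖ℓ m‖ ≤ Real.exp ‖ℓ m‖ := by linarith [Real.add_one_le_exp ‖ℓ m‖]
    have h₂ : (‖z‖ + 2) * ‖ℓ m‖ = (‖z‖ + 1) * ‖ℓ m‖ + ‖ℓ m‖ := by ring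
    rw [norm_smul, norm_mul, h₂, Real.exp_add, ← mul_assoc]
    gcongr
    exact bound m x hx
  have hz : z ∈ Metric.ball (0 : E) (‖z‖ + 1) := by simp
  have hderiv := hasFDerivAt_tsum_of_isPreconnected (𝕜 := ℂ)
    (f := fun m x => c m * exp (ℓ m x)) (f' := fun m x => (c m * exp (ℓ m x)) • ℓ m)
    key Metric.isOpen_ball
    (letI := NormedSpace.restrictScalars ℝ ℂ E; (convex_ball (0 : E) (‖z‖ + 1)).isPreconnected)
    (fun m x _ => by
      simpa [smul_smul] using ((ℓ m).hasFDerivAt (x := x)).cexp.const_mul (c m))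
    bound' (x₀ := 0) (by simp; positivity)
    (by simpa using h.summable_norm.of_norm) hz
  have hsum : Summable fun m => (c m * exp (ℓ m z)) • ℓ m :=
    Summable.of_norm_bounded key fun m => bound' m z hz
  rw [hderiv.fderiv]
  refine ((ContinuousLinearMap.apply ℂ ℂ v).map_tsum hsum).trans (tsum_congr fun m => ?_)
  simp
  ring

end ExponentialSeries

section GaussianDecay

open Matrix

variable {g : ℕ}

theorem summable_prod_pi {f : ℤ → ℝ} (hf : Summable f) (h0 : ∀ n, 0 ≤ f n) (g : ℕ) :
    Summable fun m : Fin g → ℤ => ∏ k, f (m k) := by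
  induction g with
  | zero => exact (hasSum_fintype _).summable
  | succ g ih =>
    rw [← (Fin.consEquiv fun _ : Fin (g + 1) => ℤ).summable_iff]
    refine (hf.mul_of_nonneg ih h0 fun m => Finset.prod_nonneg fun k _ => h0 _).congr fun x => ?_
    simp [Fin.prod_univ_succ, Fin.consEquiv]

theorem summable_exp_neg_abs : Summable fun n : ℤ => Real.exp (-|(n : ℝ)|) := by
  refine Summable.of_nat_of_neg ?_ ?_ <;>
  · simpa using Real.summable_exp_neg_nat

/-- A positive definite real quadratic form is bounded below by a multiple of the squared norm. -/
theorem Matrix.PosDef.exists_mul_sq_norm_le {Y : Matrix (Fin g) (Fin g) ℝ} (hY : Y.PosDef) :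
    ∃ c > 0, ∀ x : Fin g → ℝ, c * ‖x‖ ^ 2 ≤ x ⬝ᵥ Y *ᵥ x := by
  have hcont : Continuous fun x : Fin g → ℝ => x ⬝ᵥ Y *ᵥ x := by
    unfold dotProduct mulVec dotProduct
    fun_prop
  rcases (Metric.sphere (0 : Fin g → ℝ) 1).eq_empty_or_nonempty with he | hne
  · refine ⟨1, one_pos, fun x => ?_⟩
    have hx : x = 0 := by
      by_contra hx
      have : ‖x‖⁻¹ • x ∈ Metric.sphere (0 : Fin g → ℝ) 1 := by
        simp [norm_smul, hx]
      simp [he] at this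
    simp [hx]
  · obtain ⟨y, hy, hmin⟩ := (isCompact_sphere (0 : Fin g → ℝ) 1).exists_isMinOn hne
      hcont.continuousOn
    have hy0 : y ≠ 0 := by
      rintro rfl
      simp at hy
    refine ⟨y ⬝ᵥ Y *ᵥ y, by simpa using hY.dotProduct_mulVec_pos hy0, fun x => ?_⟩
    by_cases hx : x = 0
    · simp [hx]
    have hmem : ‖x‖⁻¹ • x ∈ Metric.sphere (0 : Fin g → ℝ) 1 := by
      simp [norm_smul, hx]
    have h := hmin hmem
    simp only [Set.mem_ofPred_eq, mulVec_smul, dotProduct_smul, smul_dotProduct, smul_eq_mul] at h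
    have hn : 0 < ‖x‖ := norm_pos_iff.2 hx
    calc _ ≤ (‖x‖⁻¹ * (‖x‖⁻¹ * x ⬝ᵥ Y *ᵥ x)) * ‖x‖ ^ 2 := by gcongr
      _ = _ := by field_simp

/-- Gaussian sums over a shifted lattice converge, even with an exponential weight. -/
theorem summable_gaussian {Y : Matrix (Fin g) (Fin g) ℝ} (hY : Y.PosDef) (e : Fin g → ℝ)
    (R : ℝ) :
    Summable fun m : Fin g → ℤ =>
      Real.exp (-Real.pi * ((fun k => (m k : ℝ) + e k) ⬝ᵥ Y *ᵥ fun k => (m k : ℝ) + e k) +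
        R * ‖fun k => (m k : ℝ) + e k‖) := by
  obtain ⟨c, hc, hcY⟩ := hY.exists_mul_sq_norm_le
  have ha : 0 < Real.pi * c := by positivity
  refine Summable.of_nonneg_of_le (fun m => (Real.exp_pos _).le) (fun m => ?_)
    ((summable_prod_pi summable_exp_neg_abs (fun n => (Real.exp_pos _).le) g).mul_left
      (Real.exp ((R + g) ^ 2 / (4 * (Real.pi * c)) + ∑ k, |e k|)))
  rw [← Real.exp_sum, ← Real.exp_add, Real.exp_le_exp]
  set x : Fin g → ℝ := fun k => (m k : ℝ) + e k with hx
  have h₁ : ∑ k, |(m k : ℝ)| ≤ g * ‖x‖ + ∑ k, |e k| := by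
    have : ∀ k, |(m k : ℝ)| ≤ ‖x‖ + |e k| := fun k => by
      have h := norm_le_pi_norm x k
      have h' : (m k : ℝ) = x k - e k := by simp [hx]
      rw [h']
      exact (abs_sub _ _).trans (by gcongr; exact h)
    calc _ ≤ ∑ k, (‖x‖ + |e k|) := Finset.sum_le_sum fun k _ => this k
      _ = _ := by simp [Finset.sum_add_distrib]
  have h₂ : (R + g) * ‖x‖ ≤ (R + g) ^ 2 / (4 * (Real.pi * c)) + Real.pi * c * ‖x‖ ^ 2 := by
    have : 0 ≤ (R + g - 2 * (Real.pi * c) * ‖x‖) ^ 2 / (4 * (Real.pi * c)) := by positivity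
    have h : (R + g - 2 * (Real.pi * c) * ‖x‖) ^ 2 / (4 * (Real.pi * c)) =
        (R + g) ^ 2 / (4 * (Real.pi * c)) + Real.pi * c * ‖x‖ ^ 2 - (R + g) * ‖x‖ := by
      field_simp
      ring
    linarith
  have h₃ : Real.pi * (c * ‖x‖ ^ 2) ≤ Real.pi * (x ⬝ᵥ Y *ᵥ x) := by
    gcongr
    exact hcY x
  rw [Finset.sum_neg_distrib]
  linarith

end GaussianDecay

section ThetaSeries

open Matrix

variable {g : ℕ}

/-- The shifted lattice point `m + ε/2`. -/
def halfShift (ε m : Fin g → ℤ) : Fin g → ℂ := fun k => (m k : ℂ) + (ε k : ℂ) / 2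

/-- The summand `exp(πi(pᵀτp + p·δ))` of a theta constant, at the point `p`. -/
def thetaTerm (τ : Matrix (Fin g) (Fin g) ℂ) (δ : Fin g → ℤ) (p : Fin g → ℂ) : ℂ :=
  exp (Real.pi * I * (p ⬝ᵥ τ *ᵥ p + p ⬝ᵥ fun k => (δ k : ℂ)))

/-- The functional `z ↦ 2πi s p·z`. -/
def phase (s : ℂ) (p : Fin g → ℂ) : (Fin g → ℂ) →L[ℂ] ℂ :=
  (2 * Real.pi * I * s) • ∑ k, p k • ContinuousLinearMap.proj k

theorem phase_apply (s : ℂ) (p z : Fin g → ℂ) :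
    phase s p z = 2 * Real.pi * I * s * (p ⬝ᵥ z) := by
  simp [phase, dotProduct]

theorem phase_single (s : ℂ) (p : Fin g → ℂ) (i : Fin g) :
    phase s p (Pi.single i 1) = 2 * Real.pi * I * s * p i := by
  simp [phase_apply]

theorem norm_phase_le (s : ℂ) (p : Fin g → ℂ) :
    ‖phase s p‖ ≤ 2 * Real.pi * ‖s‖ * g * ‖p‖ := by
  refine ContinuousLinearMap.opNorm_le_bound _ (by positivity) fun z => ?_
  have h : ‖p ⬝ᵥ z‖ ≤ g * ‖p‖ * ‖z‖ := by
    refine (norm_sum_le _ _).trans ?_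
    calc _ ≤ ∑ _k : Fin g, ‖p‖ * ‖z‖ := Finset.sum_le_sum fun k _ => by
          rw [norm_mul]
          gcongr <;> exact norm_le_pi_norm _ k
      _ = _ := by simp [mul_assoc]
  rw [phase_apply]
  simp only [norm_mul, norm_I, mul_one, Complex.norm_real, Real.norm_eq_abs,
    abs_of_pos Real.pi_pos, Complex.norm_ofNat]
  calc _ ≤ 2 * Real.pi * ‖s‖ * (g * ‖p‖ * ‖z‖) := by gcongr
    _ = _ := by ring

theorem theta_eq_tsum_thetaTerm (τ : Matrix (Fin g) (Fin g) ℂ) (ε δ : Fin g → ℤ) (s : ℂ)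
    (z : Fin g → ℂ) :
    theta τ ε δ (fun k => s * z k) =
      ∑' m, thetaTerm τ δ (halfShift ε m) * exp (phase s (halfShift ε m) z) := by
  refine tsum_congr fun m => ?_
  rw [thetaTerm, ← Complex.exp_add, phase_apply]
  congr 1
  have h₁ : (∑ i, ∑ j, ((m i : ℂ) + (ε i : ℂ) / 2) * τ i j * ((m j : ℂ) + (ε j : ℂ) / 2)) =
      halfShift ε m ⬝ᵥ τ *ᵥ halfShift ε m := by
    simp [halfShift, dotProduct, mulVec, Finset.mul_sum, mul_assoc]
  have h₂ : 2 * ∑ i, ((m i : ℂ) + (ε i : ℂ) / 2) * (s * z i + (δ i : ℂ) / 2) =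
      2 * s * (halfShift ε m ⬝ᵥ z) + halfShift ε m ⬝ᵥ fun k => (δ k : ℂ) := by
    simp only [halfShift, dotProduct, Finset.mul_sum, ← Finset.sum_add_distrib]
    exact Finset.sum_congr rfl fun k _ => by ring
  rw [h₁, h₂]
  ring

theorem IsSiegel.two_smul {τ : Matrix (Fin g) (Fin g) ℂ} (hτ : IsSiegel τ) :
    IsSiegel ((2 : ℂ) • τ) := by
  refine ⟨hτ.1.smul 2, ?_⟩
  convert hτ.2.smul (two_pos : (0 : ℝ) < 2) using 1
  ext i j
  simp

theorem norm_thetaTerm_halfShift (τ : Matrix (Fin g) (Fin g) ℂ) (ε δ m : Fin g → ℤ) :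
    ‖thetaTerm τ δ (halfShift ε m)‖ =
      Real.exp (-Real.pi * ((fun k => (m k : ℝ) + (ε k : ℝ) / 2) ⬝ᵥ
        (Matrix.of fun i j => (τ i j).im) *ᵥ fun k => (m k : ℝ) + (ε k : ℝ) / 2)) := by
  have hp : ∀ k, halfShift ε m k = (((m k : ℝ) + (ε k : ℝ) / 2 : ℝ) : ℂ) := fun k => by
    simp [halfShift]
  have h₁ : (halfShift ε m ⬝ᵥ fun k => (δ k : ℂ)).im = 0 := by
    simp only [dotProduct, hp, Complex.im_sum]
    refine Finset.sum_eq_zero fun k _ => ?_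
    rw [Complex.im_ofReal_mul, Complex.intCast_im, mul_zero]
  have h₂ : (halfShift ε m ⬝ᵥ τ *ᵥ halfShift ε m).im =
      (fun k => (m k : ℝ) + (ε k : ℝ) / 2) ⬝ᵥ
        (Matrix.of fun i j => (τ i j).im) *ᵥ fun k => (m k : ℝ) + (ε k : ℝ) / 2 := by
    simp only [dotProduct, mulVec, hp, Complex.im_sum, Complex.im_ofReal_mul,
      Complex.im_mul_ofReal, Matrix.of_apply]
  rw [thetaTerm, Complex.norm_exp, ← h₂]
  congr 1
  simp [h₁]

theorem IsSiegel.expDecay {τ : Matrix (Fin g) (Fin g) ℂ} (hτ : IsSiegel τ) (ε δ : Fin g → ℤ)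
    (s : ℂ) :
    ExpDecay (fun m => thetaTerm τ δ (halfShift ε m)) fun m => phase s (halfShift ε m) := by
  intro R
  refine Summable.of_nonneg_of_le (fun m => by positivity) (fun m => ?_)
    (summable_gaussian hτ.2 (fun k => (ε k : ℝ) / 2) (|R| * (2 * Real.pi * ‖s‖ * g)))
  have hp : ‖halfShift ε m‖ = ‖fun k => (m k : ℝ) + (ε k : ℝ) / 2‖ := by
    rw [Pi.norm_def, Pi.norm_def]
    congr 1
    refine Finset.sup_congr rfl fun k _ => NNReal.eq ?_
    rw [coe_nnnorm, coe_nnnorm, ← Complex.norm_real]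
    simp [halfShift]
  rw [norm_thetaTerm_halfShift, ← Real.exp_add, Real.exp_le_exp, ← hp]
  refine add_le_add le_rfl ?_
  calc _ ≤ |R| * (2 * Real.pi * ‖s‖ * g * ‖halfShift ε m‖) :=
        mul_le_mul (le_abs_self R) (norm_phase_le _ _) (norm_nonneg _) (abs_nonneg _)
    _ = _ := by ring

variable {τ : Matrix (Fin g) (Fin g) ℂ}

theorem theta_zero (τ : Matrix (Fin g) (Fin g) ℂ) (ε δ : Fin g → ℤ) :
    theta τ ε δ 0 = ∑' m, thetaTerm τ δ (halfShift ε m) := by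
  have h := theta_eq_tsum_thetaTerm τ ε δ 1 0
  simp only [map_zero, Complex.exp_zero, mul_one, one_mul] at h
  exact h

theorem IsSiegel.dz_theta (hτ : IsSiegel τ) (ε δ : Fin g → ℤ) (i : Fin g) :
    dz (theta τ ε δ) i 0 =
      ∑' m, thetaTerm τ δ (halfShift ε m) * (2 * Real.pi * I * halfShift ε m i) := by
  have h : theta τ ε δ = fun z =>
      ∑' m, thetaTerm τ δ (halfShift ε m) * exp (phase 1 (halfShift ε m) z) := by
    ext z
    simpa using theta_eq_tsum_thetaTerm τ ε δ 1 z
  rw [dz, h, (hτ.expDecay ε δ 1).fderiv_tsum_apply]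
  simp [phase_single]

theorem IsSiegel.D2_theta (hτ : IsSiegel τ) (ε δ : Fin g → ℤ) (i j : Fin g) :
    D2 (fun z => theta τ ε δ fun k => 2 * z k) i j =
      ∑' m, thetaTerm τ δ (halfShift ε m) *
        ((4 * Real.pi * I) ^ 2 * (halfShift ε m i * halfShift ε m j)) := by
  simp only [D2, theta_eq_tsum_thetaTerm]
  simp only [(hτ.expDecay ε δ 2).fderiv_tsum_apply,
    ((hτ.expDecay ε δ 2).mul_apply _).fderiv_tsum_apply]
  refine tsum_congr fun m => ?_
  simp only [phase_single, map_zero, Complex.exp_zero]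
  ring

theorem IsSiegel.summable_norm_thetaTerm (hτ : IsSiegel τ) (ε δ : Fin g → ℤ) :
    Summable fun m => ‖thetaTerm τ δ (halfShift ε m)‖ :=
  (hτ.expDecay ε δ 1).summable_norm

theorem IsSiegel.summable_norm_dz (hτ : IsSiegel τ) (ε δ : Fin g → ℤ) (i : Fin g) :
    Summable fun m =>
      ‖thetaTerm τ δ (halfShift ε m) * (2 * Real.pi * I * halfShift ε m i)‖ := by
  simpa [phase_single] using ((hτ.expDecay ε δ 1).mul_apply (Pi.single i 1)).summable_norm

theorem IsSiegel.summable_norm_D2 (hτ : IsSiegel τ) (ε δ : Fin g → ℤ) (i j : Fin g) :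
    Summable fun m => ‖thetaTerm τ δ (halfShift ε m) *
        ((4 * Real.pi * I) ^ 2 * (halfShift ε m i * halfShift ε m j))‖ := by
  refine (((hτ.expDecay ε δ 2).mul_apply (Pi.single j 1)).mul_apply
    (Pi.single i 1)).summable_norm.congr fun m => ?_
  simp only [phase_single]
  congr 1
  ring

end ThetaSeries

section CharacterSums

open Matrix

variable {g : ℕ}

theorem exp_pi_I_mul_int (n : ℤ) : exp (Real.pi * I * n) = (-1) ^ n := by
  rw [mul_comm, Complex.exp_int_mul, Complex.exp_pi_mul_I]

/-- Orthogonality of the characters of `(ℤ/2ℤ)^g`. -/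
theorem sum_neg_one_zpow (N : Fin g → ℤ) [Decidable (∀ k, Even (N k))] :
    ∑ σ : Fin g → Fin 2, (-1 : ℂ) ^ (∑ k, N k * ((σ k : ℕ) : ℤ)) =
      if ∀ k, Even (N k) then 2 ^ g else 0 := by
  have h : ∀ σ : Fin g → Fin 2, (-1 : ℂ) ^ (∑ k, N k * ((σ k : ℕ) : ℤ)) =
      ∏ k, (-1 : ℂ) ^ (N k * ((σ k : ℕ) : ℤ)) := fun σ => by
    simp only [← exp_pi_I_mul_int, ← Complex.exp_sum, Int.cast_sum, Finset.mul_sum]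
  simp only [h]
  rw [← Fintype.prod_sum (fun k (s : Fin 2) => (-1 : ℂ) ^ (N k * ((s : ℕ) : ℤ)))]
  split_ifs with hN
  · simp [(hN _).neg_one_zpow, one_add_one_eq_two]
  · push Not at hN
    obtain ⟨k, hk⟩ := hN
    exact Finset.prod_eq_zero (Finset.mem_univ k)
      (by simp [(Int.not_even_iff_odd.1 hk).neg_one_zpow])

theorem thetaTerm_mul_thetaTerm (τ : Matrix (Fin g) (Fin g) ℂ) (β : Fin g → ℤ)
    (u v : Fin g → ℂ) :
    thetaTerm τ β (u + v) * thetaTerm τ 0 (u - v) =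
      thetaTerm ((2 : ℂ) • τ) β u * thetaTerm ((2 : ℂ) • τ) β v := by
  simp only [thetaTerm, ← Complex.exp_add]
  congr 1
  simp only [mulVec_add, mulVec_sub, dotProduct_add, dotProduct_sub, add_dotProduct,
    sub_dotProduct, smul_mulVec, dotProduct_smul, smul_eq_mul, Pi.zero_apply, Int.cast_zero]
  have h : ∀ p : Fin g → ℂ, (p ⬝ᵥ fun _ => (0 : ℂ)) = 0 := fun p => by simp [dotProduct]
  rw [h, h]
  ring

theorem thetaTerm_add (τ : Matrix (Fin g) (Fin g) ℂ) (β σ : Fin g → ℤ) (p : Fin g → ℂ) :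
    thetaTerm τ (β + σ) p =
      thetaTerm τ β p * exp (Real.pi * I * (p ⬝ᵥ fun k => (σ k : ℂ))) := by
  have h : (fun k => (((β + σ) k : ℤ) : ℂ)) = (fun k => (β k : ℂ)) + fun k => (σ k : ℂ) := by
    ext k
    simp
  rw [thetaTerm, thetaTerm, ← Complex.exp_add, h, dotProduct_add]
  congr 1
  ring

/-- Shifting both characteristics by `σ` changes a product of theta terms by a sign. -/
theorem thetaTerm_add_mul_thetaTerm (τ : Matrix (Fin g) (Fin g) ℂ) (β σ ε m n : Fin g → ℤ) :
    thetaTerm τ (β + σ) (halfShift ε m) * thetaTerm τ σ (halfShift ε n) =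
      thetaTerm τ β (halfShift ε m) * thetaTerm τ 0 (halfShift ε n) *
        (-1) ^ (∑ k, (m k + n k + ε k) * σ k) := by
  have h := thetaTerm_add τ 0 σ (halfShift ε n)
  rw [zero_add] at h
  rw [thetaTerm_add, h, ← exp_pi_I_mul_int]
  have h' : exp (Real.pi * I * ((∑ k, (m k + n k + ε k) * σ k : ℤ) : ℂ)) =
      exp (Real.pi * I * (halfShift ε m ⬝ᵥ fun k => (σ k : ℂ))) *
        exp (Real.pi * I * (halfShift ε n ⬝ᵥ fun k => (σ k : ℂ))) := by
    rw [← Complex.exp_add, ← mul_add]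
    congr 2
    simp only [dotProduct, ← Finset.sum_add_distrib, halfShift]
    push_cast
    exact Finset.sum_congr rfl fun k _ => by ring
  rw [h']
  ring

theorem halfShift_neg (ε m : Fin g → ℤ) : halfShift ε (-m - ε) = -halfShift ε m := by
  ext k
  simp [halfShift]
  ring

/-- The gradient at the origin of a theta function with even characteristic vanishes. -/
theorem IsSiegel.dz_theta_eq_zero {τ : Matrix (Fin g) (Fin g) ℂ} (hτ : IsSiegel τ)
    {ε δ : Fin g → ℤ} (h : Even (∑ k, ε k * δ k)) (i : Fin g) :
    dz (theta τ ε δ) i 0 = 0 := by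
  have hterm : ∀ m, thetaTerm τ δ (halfShift ε (-m - ε)) = thetaTerm τ δ (halfShift ε m) := by
    intro m
    obtain ⟨a, ha⟩ := h
    have hp : halfShift ε m ⬝ᵥ (fun k => (δ k : ℂ)) =
        (∑ k, m k * δ k : ℤ) + a := by
      have ha' : ((∑ k, ε k * δ k : ℤ) : ℂ) = a + a := by exact_mod_cast ha
      have : (a : ℂ) = ((∑ k, ε k * δ k : ℤ) : ℂ) / 2 := by rw [ha']; ring
      rw [this]
      push_cast
      rw [Finset.sum_div, ← Finset.sum_add_distrib]
      exact Finset.sum_congr rfl fun k _ => by simp only [halfShift]; ring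
    rw [thetaTerm, thetaTerm, halfShift_neg, mulVec_neg, neg_dotProduct, neg_dotProduct,
      dotProduct_neg, neg_neg, hp, Complex.exp_eq_exp_iff_exists_int]
    refine ⟨-(∑ k, m k * δ k + a), ?_⟩
    push_cast
    ring
  have hsymm : dz (theta τ ε δ) i 0 = -dz (theta τ ε δ) i 0 := by
    rw [hτ.dz_theta, ← tsum_neg]
    rw [← ((Equiv.neg (Fin g → ℤ)).trans (Equiv.subRight ε)).tsum_eq]
    refine tsum_congr fun m => ?_
    simp only [Equiv.trans_apply, Equiv.neg_apply, Equiv.subRight_apply, hterm]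
    simp [halfShift_neg]
  exact self_eq_neg.1 hsymm

end CharacterSums

section Doubling

variable {g : ℕ} {τ : Matrix (Fin g) (Fin g) ℂ}

theorem hasSum_mul_of_summable_norm {ι κ : Type*} {f : ι → ℂ} {h : κ → ℂ}
    (hf : Summable fun m => ‖f m‖) (hh : Summable fun n => ‖h n‖) :
    HasSum (fun x : ι × κ => f x.1 * h x.2) ((∑' m, f m) * ∑' n, h n) := by
  rw [tsum_mul_tsum_of_summable_norm hf hh]
  exact (summable_mul_of_summable_norm hf hh).hasSum

/-- The double series behind `C^β_{ij,εσ}`, without the sign depending on `σ`. -/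
def gradTerm (τ : Matrix (Fin g) (Fin g) ℂ) (i j : Fin g) (ε β : Fin g → ℤ)
    (x : (Fin g → ℤ) × (Fin g → ℤ)) : ℂ :=
  (2 * Real.pi * I) ^ 2 *
    (halfShift ε x.1 i * halfShift ε x.2 j + halfShift ε x.1 j * halfShift ε x.2 i) *
      (thetaTerm τ β (halfShift ε x.1) * thetaTerm τ 0 (halfShift ε x.2))

theorem IsSiegel.hasSum_Ccoef (hτ : IsSiegel τ) (i j : Fin g) (ε σ β : Fin g → ℤ) :
    HasSum (fun x => gradTerm τ i j ε β x * (-1) ^ (∑ k, (x.1 k + x.2 k + ε k) * σ k))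
      (Ccoef τ i j ε σ β) := by
  have hprod : ∀ i j : Fin g, HasSum
      (fun x : (Fin g → ℤ) × (Fin g → ℤ) =>
        (thetaTerm τ (β + σ) (halfShift ε x.1) * (2 * Real.pi * I * halfShift ε x.1 i)) *
          (thetaTerm τ σ (halfShift ε x.2) * (2 * Real.pi * I * halfShift ε x.2 j)))
      (dz (theta τ ε (β + σ)) i 0 * dz (theta τ ε σ) j 0) := by
    intro i j
    rw [hτ.dz_theta, hτ.dz_theta]
    have h := hasSum_mul_of_summable_norm (hτ.summable_norm_dz ε (β + σ) i)
      (hτ.summable_norm_dz ε σ j)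
    exact h
  refine ((hprod i j).add (hprod j i)).congr_fun fun x => ?_
  have h := thetaTerm_add_mul_thetaTerm τ β σ ε x.1 x.2
  rw [gradTerm]
  linear_combination -(2 * Real.pi * I) ^ 2 *
    (halfShift ε x.1 i * halfShift ε x.2 j + halfShift ε x.1 j * halfShift ε x.2 i) * h

theorem IsSiegel.Ccoef_eq_zero (hτ : IsSiegel τ) (i j : Fin g) {ε σ : Fin g → ℤ}
    (β : Fin g → ℤ) (h : Even (∑ k, ε k * σ k)) : Ccoef τ i j ε σ β = 0 := by
  simp [Ccoef, hτ.dz_theta_eq_zero h]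

/-- The change of lattice variables `(u, v) ↦ (u + v, u - v)` in terms of integer points. -/
def doubling (α ε : Fin g → ℤ) (x : (Fin g → ℤ) × (Fin g → ℤ)) : (Fin g → ℤ) × (Fin g → ℤ) :=
  (x.1 + x.2 + α, x.1 - x.2 - ε)

theorem halfShift_doubling_fst (α ε : Fin g → ℤ) (x : (Fin g → ℤ) × (Fin g → ℤ)) :
    halfShift ε (doubling α ε x).1 = halfShift α x.1 + halfShift (α + ε) x.2 := by
  ext k
  simp [halfShift, doubling]
  ring

theorem halfShift_doubling_snd (α ε : Fin g → ℤ) (x : (Fin g → ℤ) × (Fin g → ℤ)) :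
    halfShift ε (doubling α ε x).2 = halfShift α x.1 - halfShift (α + ε) x.2 := by
  ext k
  simp [halfShift, doubling]
  ring

theorem doubling_injective (α ε : Fin g → ℤ) : Function.Injective (doubling α ε) := by
  rintro ⟨a, b⟩ ⟨a', b'⟩ h
  simp only [doubling, Prod.mk.injEq] at h
  refine Prod.ext (funext fun k => ?_) (funext fun k => ?_) <;>
  · have h₁ := congrFun h.1 k
    have h₂ := congrFun h.2 k
    simp only [Pi.add_apply, Pi.sub_apply] at h₁ h₂
    dsimp only
    omega

theorem mem_range_doubling (α ε : Fin g → ℤ) (x : (Fin g → ℤ) × (Fin g → ℤ)) :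
    x ∈ Set.range (doubling α ε) ↔ ∀ k, Even (α k + (x.1 k + x.2 k + ε k)) := by
  constructor
  · rintro ⟨y, rfl⟩ k
    exact ⟨y.1 k + α k, by simp only [doubling, Pi.add_apply, Pi.sub_apply]; ring⟩
  · intro h
    choose c hc using h
    refine ⟨(fun k => c k - α k, fun k => x.1 k - c k), ?_⟩
    refine Prod.ext (funext fun k => ?_) (funext fun k => ?_) <;>
    · have := hc k
      simp only [doubling, Pi.add_apply, Pi.sub_apply]
      omega

theorem gradTerm_doubling (τ : Matrix (Fin g) (Fin g) ℂ) (i j : Fin g) (α ε β : Fin g → ℤ)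
    (x : (Fin g → ℤ) × (Fin g → ℤ)) :
    2 * gradTerm τ i j ε β (doubling α ε x) =
      (thetaTerm ((2 : ℂ) • τ) β (halfShift α x.1) *
          ((4 * Real.pi * I) ^ 2 * (halfShift α x.1 i * halfShift α x.1 j))) *
        thetaTerm ((2 : ℂ) • τ) β (halfShift (α + ε) x.2) -
      thetaTerm ((2 : ℂ) • τ) β (halfShift α x.1) *
        (thetaTerm ((2 : ℂ) • τ) β (halfShift (α + ε) x.2) *
          ((4 * Real.pi * I) ^ 2 * (halfShift (α + ε) x.2 i * halfShift (α + ε) x.2 j))) := by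
  rw [gradTerm, halfShift_doubling_fst, halfShift_doubling_snd, thetaTerm_mul_thetaTerm]
  simp only [Pi.add_apply, Pi.sub_apply]
  ring

theorem IsSiegel.hasSum_Acoef (hτ : IsSiegel τ) (i j : Fin g) (α ε β : Fin g → ℤ) :
    HasSum (fun x => 2 * gradTerm τ i j ε β (doubling α ε x)) (Acoef τ i j (α + ε) α β) := by
  simp only [gradTerm_doubling]
  have h := hτ.two_smul
  rw [Acoef, h.D2_theta, h.D2_theta, theta_zero, theta_zero]
  have h₁ := hasSum_mul_of_summable_norm (h.summable_norm_D2 α β i j)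
    (h.summable_norm_thetaTerm (α + ε) β)
  have h₂ := hasSum_mul_of_summable_norm (h.summable_norm_thetaTerm α β)
    (h.summable_norm_D2 (α + ε) β i j)
  exact h₁.sub h₂

open Classical in
/-- The signed sum of all `C^β_{ij,εσ}` picks out the image of `doubling`. -/
theorem IsSiegel.hasSum_sum_Ccoef (hτ : IsSiegel τ) (i j : Fin g) (α ε β : Fin g → ℤ) :
    HasSum (fun x => 2 ^ g * gradTerm τ i j ε β (doubling α ε x))
      (∑ σ : Fin g → Fin 2, (-1 : ℂ) ^ (∑ k, α k * ((σ k : ℕ) : ℤ)) *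
        Ccoef τ i j ε (fun k => ((σ k : ℕ) : ℤ)) β) := by
  have h := hasSum_sum (s := Finset.univ) fun (σ : Fin g → Fin 2) _ =>
    (hτ.hasSum_Ccoef i j ε (fun k => ((σ k : ℕ) : ℤ)) β).mul_left
      ((-1 : ℂ) ^ (∑ k, α k * ((σ k : ℕ) : ℤ)))
  have hterm : ∀ x : (Fin g → ℤ) × (Fin g → ℤ),
      (∑ σ : Fin g → Fin 2, (-1 : ℂ) ^ (∑ k, α k * ((σ k : ℕ) : ℤ)) *
        (gradTerm τ i j ε β x *
          (-1) ^ (∑ k, (x.1 k + x.2 k + ε k) * ((σ k : ℕ) : ℤ)))) =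
      gradTerm τ i j ε β x * if x ∈ Set.range (doubling α ε) then 2 ^ g else 0 := by
    intro x
    simp only [mem_range_doubling]
    rw [← sum_neg_one_zpow, Finset.mul_sum]
    refine Finset.sum_congr rfl fun σ _ => ?_
    simp only [add_mul (α _), Finset.sum_add_distrib]
    rw [zpow_add₀ (by norm_num)]
    ring
  simp only [hterm] at h
  rw [← (doubling_injective α ε).hasSum_iff fun x hx => by simp [hx]] at h
  refine h.congr_fun fun x => ?_
  simp [mul_comm]

end Doubling

theorem statement1 {g : ℕ} (hg : 1 ≤ g) (τ : Matrix (Fin g) (Fin g) ℂ)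
    (hτ : IsSiegel τ) (i j : Fin g) (α ε β : Fin g → ℤ)
    (hα : ∀ k, α k = 0 ∨ α k = 1) (hε : ∀ k, ε k = 0 ∨ ε k = 1)
    (hβ : ∀ k, β k = 0 ∨ β k = 1)
    (heven₁ : Even (∑ k, α k * β k)) (heven₂ : Even (∑ k, (α k + ε k) * β k)) :
    Acoef τ i j (α + ε) α β =
      (2 : ℂ) ^ ((1 : ℤ) - (g : ℤ)) *
        ∑ σ ∈ Finset.univ.filter
            (fun σ : Fin g → Fin 2 => Odd (∑ k, ε k * ((σ k : ℕ) : ℤ))),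
          (-1 : ℂ) ^ (∑ k, α k * ((σ k : ℕ) : ℤ)) *
            Ccoef τ i j ε (fun k => ((σ k : ℕ) : ℤ)) β := by
  have hall : ∑ σ ∈ Finset.univ.filter
        (fun σ : Fin g → Fin 2 => Odd (∑ k, ε k * ((σ k : ℕ) : ℤ))),
        (-1 : ℂ) ^ (∑ k, α k * ((σ k : ℕ) : ℤ)) *
          Ccoef τ i j ε (fun k => ((σ k : ℕ) : ℤ)) β =
      ∑ σ : Fin g → Fin 2, (-1 : ℂ) ^ (∑ k, α k * ((σ k : ℕ) : ℤ)) *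
        Ccoef τ i j ε (fun k => ((σ k : ℕ) : ℤ)) β := by
    refine Finset.sum_filter_of_ne fun σ _ hσ => ?_
    by_contra hodd
    exact hσ (by rw [hτ.Ccoef_eq_zero i j β (Int.not_odd_iff_even.1 hodd), mul_zero])
  rw [hall]
  refine (hτ.hasSum_Acoef i j α ε β).unique ?_
  refine ((hτ.hasSum_sum_Ccoef i j α ε β).mul_left _).congr_fun fun x => ?_
  rw [← mul_assoc, ← zpow_natCast, ← zpow_add₀ two_ne_zero]
  simp
end
end

section
/- Let g ≥ 1 and let τ be an element of the Siegel upper half-space H_g. Then the gradient vectors grad_z θ[ε,δ](τ,0) := (∂_{z_1}θ[ε,δ](τ,0), …, ∂_{z_g}θ[ε,δ](τ,0)) ∈ ℂ^g, taken over all odd characteristics, i.e. all ε, δ ∈ {0,1}^g ⊂ ℤ^g with ε·δ odd, span ℂ^g. Equivalently, the 2^{g−1}(2^g−1) × g matrix whose rows are these gradients has rank g. -/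
open scoped BigOperators
open Complex

noncomputable section

section ThetaGradients

open Matrix Filter Topology

section ExpSeries

variable {ι : Type*} {g : ℕ}

/-- The coefficients `p` decay faster than any exponential in the frequencies `x`. -/
def RapidDecay (x : ι → Fin g → ℂ) (p : ι → ℂ) : Prop :=
  ∀ R : ℝ, Summable fun i => ‖p i‖ * Real.exp (R * ∑ j, ‖x i j‖)

/-- The exponential series `∑ p i * exp (2πi x i · z)`. -/
def expSeries (x : ι → Fin g → ℂ) (p : ι → ℂ) (z : Fin g → ℂ) : ℂ :=
  ∑' i, p i * cexp (2 * Real.pi * I * (x i ⬝ᵥ z))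

lemma norm_dotProduct_le (x z : Fin g → ℂ) : ‖x ⬝ᵥ z‖ ≤ (∑ j, ‖x j‖) * ‖z‖ := by
  rw [dotProduct, Finset.sum_mul]
  refine (norm_sum_le _ _).trans (Finset.sum_le_sum fun j _ => ?_)
  rw [norm_mul]
  gcongr
  exact norm_le_pi_norm z j

lemma norm_cexp_dotProduct_le (x z : Fin g → ℂ) :
    ‖cexp (2 * Real.pi * I * (x ⬝ᵥ z))‖ ≤ Real.exp (2 * Real.pi * ‖z‖ * ∑ j, ‖x j‖) := by
  rw [Complex.norm_exp]
  refine Real.exp_le_exp.mpr ((Complex.re_le_norm _).trans ?_)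
  have h := norm_dotProduct_le x z
  have hpi := Real.pi_pos
  rw [norm_mul, norm_mul, norm_mul]
  simp only [Complex.norm_ofNat, Complex.norm_real, Real.norm_eq_abs, abs_of_pos hpi, norm_I]
  nlinarith [mul_le_mul_of_nonneg_left h hpi.le]

lemma RapidDecay.mul_of_le {x : ι → Fin g → ℂ} {p q : ι → ℂ} (hp : RapidDecay x p) {C R : ℝ}
    (hq : ∀ i, ‖q i‖ ≤ C * Real.exp (R * ∑ j, ‖x i j‖)) : RapidDecay x fun i => p i * q i := by
  intro S
  refine Summable.of_nonneg_of_le (fun i => by positivity) (fun i => ?_)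
    ((hp (R + S)).mul_left C)
  rw [norm_mul, add_mul, Real.exp_add]
  calc ‖p i‖ * ‖q i‖ * Real.exp (S * ∑ j, ‖x i j‖)
      ≤ ‖p i‖ * (C * Real.exp (R * ∑ j, ‖x i j‖)) * Real.exp (S * ∑ j, ‖x i j‖) := by
        gcongr
        exact hq i
    _ = _ := by ring

lemma RapidDecay.mul_dotProduct {x : ι → Fin g → ℂ} {p : ι → ℂ} (hp : RapidDecay x p)
    (v : Fin g → ℂ) : RapidDecay x fun i => p i * (2 * Real.pi * I * (x i ⬝ᵥ v)) := by
  refine hp.mul_of_le (C := 2 * Real.pi * ‖v‖) (R := 1) fun i => ?_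
  have h := norm_dotProduct_le (x i) v
  have hpi := Real.pi_pos
  have hexp : ∑ j, ‖x i j‖ ≤ Real.exp (1 * ∑ j, ‖x i j‖) := by
    rw [one_mul]
    linarith [Real.add_one_le_exp (∑ j, ‖x i j‖)]
  rw [norm_mul, norm_mul, norm_mul]
  simp only [Complex.norm_ofNat, Complex.norm_real, Real.norm_eq_abs, abs_of_pos hpi, norm_I]
  calc 2 * Real.pi * 1 * ‖x i ⬝ᵥ v‖ ≤ 2 * Real.pi * 1 * ((∑ j, ‖x i j‖) * ‖v‖) := by gcongr
    _ ≤ 2 * Real.pi * 1 * (Real.exp (1 * ∑ j, ‖x i j‖) * ‖v‖) := by gcongr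
    _ = _ := by ring

lemma RapidDecay.summable_norm {x : ι → Fin g → ℂ} {p : ι → ℂ} (hp : RapidDecay x p)
    (z : Fin g → ℂ) : Summable fun i => ‖p i * cexp (2 * Real.pi * I * (x i ⬝ᵥ z))‖ := by
  refine Summable.of_nonneg_of_le (fun i => by positivity) (fun i => ?_)
    (hp (2 * Real.pi * ‖z‖))
  rw [norm_mul]
  gcongr
  exact norm_cexp_dotProduct_le _ _

/-- The linear form `z ↦ x · z`. -/
def dotProductCLM (x : Fin g → ℂ) : (Fin g → ℂ) →L[ℂ] ℂ :=
  ∑ j, x j • ContinuousLinearMap.proj (R := ℂ) (φ := fun _ : Fin g => ℂ) j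

@[simp]
lemma dotProductCLM_apply (x z : Fin g → ℂ) : dotProductCLM x z = x ⬝ᵥ z := by
  simp [dotProductCLM, dotProduct]

lemma norm_dotProductCLM_le (x : Fin g → ℂ) : ‖dotProductCLM x‖ ≤ ∑ j, ‖x j‖ :=
  ContinuousLinearMap.opNorm_le_bound _ (by positivity) fun z => by
    simpa using norm_dotProduct_le x z

lemma RapidDecay.exists_hasFDerivAt {x : ι → Fin g → ℂ} {p : ι → ℂ} (hp : RapidDecay x p)
    (z : Fin g → ℂ) : ∃ L : (Fin g → ℂ) →L[ℂ] ℂ, HasFDerivAt (expSeries x p) L z ∧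
      ∀ v, L v = expSeries x (fun i => p i * (2 * Real.pi * I * (x i ⬝ᵥ v))) z := by
  set f' : ι → (Fin g → ℂ) → (Fin g → ℂ) →L[ℂ] ℂ := fun i y =>
    (p i * cexp (2 * Real.pi * I * (x i ⬝ᵥ y))) • ((2 * Real.pi * I : ℂ) • dotProductCLM (x i))
    with hf'
  set u : ι → ℝ := fun i => 2 * Real.pi *
    (‖p i‖ * Real.exp ((2 * Real.pi * (‖z‖ + 1) + 1) * ∑ j, ‖x i j‖)) with hu
  have hsum : Summable u := (hp _).mul_left _
  have hbound : ∀ i, ∀ y ∈ Metric.ball (0 : Fin g → ℂ) (‖z‖ + 1), ‖f' i y‖ ≤ u i := by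
    intro i y hy
    have hy' : ‖y‖ ≤ ‖z‖ + 1 := by
      rw [mem_ball_zero_iff] at hy
      exact hy.le
    have hpi := Real.pi_pos
    have hexp : ‖dotProductCLM (x i)‖ ≤ Real.exp (∑ j, ‖x i j‖) :=
      (norm_dotProductCLM_le _).trans (by linarith [Real.add_one_le_exp (∑ j, ‖x i j‖)])
    have hexp' : ‖cexp (2 * Real.pi * I * (x i ⬝ᵥ y))‖ ≤
        Real.exp (2 * Real.pi * (‖z‖ + 1) * ∑ j, ‖x i j‖) :=
      (norm_cexp_dotProduct_le _ _).trans (by gcongr)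
    simp only [hf', hu, norm_smul, norm_mul, Complex.norm_ofNat, Complex.norm_real,
      Real.norm_eq_abs, abs_of_pos hpi, norm_I]
    rw [add_mul, one_mul, Real.exp_add]
    calc ‖p i‖ * ‖cexp (2 * Real.pi * I * (x i ⬝ᵥ y))‖ * (2 * Real.pi * 1 * ‖dotProductCLM (x i)‖)
        ≤ ‖p i‖ * Real.exp (2 * Real.pi * (‖z‖ + 1) * ∑ j, ‖x i j‖) *
          (2 * Real.pi * 1 * Real.exp (∑ j, ‖x i j‖)) := by gcongr
      _ = _ := by ring
  have hz : z ∈ Metric.ball (0 : Fin g → ℂ) (‖z‖ + 1) := by simp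
  have hderiv := hasFDerivAt_tsum_of_isPreconnected (𝕜 := ℂ)
    (f := fun i y => p i * cexp (2 * Real.pi * I * (x i ⬝ᵥ y))) (f' := f') hsum
    Metric.isOpen_ball (convex_ball _ _).isPreconnected
    (fun i y _ => by
      have h1 : HasFDerivAt (fun y => 2 * Real.pi * I * (x i ⬝ᵥ y))
          ((2 * Real.pi * I : ℂ) • dotProductCLM (x i)) y := by
        simpa using ((dotProductCLM (x i)).hasFDerivAt (x := y)).const_mul (2 * Real.pi * I)
      have h2 := (h1.cexp).const_mul (p i)
      rw [smul_smul] at h2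
      exact h2)
    hbound hz (hp.summable_norm z).of_norm hz
  refine ⟨_, hderiv, fun v => ?_⟩
  have hs : Summable fun i => f' i z :=
    Summable.of_norm_bounded hsum fun i => hbound i z hz
  have h := (ContinuousLinearMap.apply ℂ ℂ v).map_tsum hs
  simp only [ContinuousLinearMap.apply_apply] at h
  rw [h, expSeries]
  refine tsum_congr fun i => ?_
  simp only [hf', _root_.smul_apply, dotProductCLM_apply, smul_eq_mul]
  ring

lemma RapidDecay.differentiable {x : ι → Fin g → ℂ} {p : ι → ℂ} (hp : RapidDecay x p) :
    Differentiable ℂ (expSeries x p) := fun z =>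
  (hp.exists_hasFDerivAt z).choose_spec.1.differentiableAt

end ExpSeries

section Gauss

variable {g : ℕ}

lemma summable_exp_neg_abs_int : Summable fun n : ℤ => Real.exp (-‖(n : ℂ)‖) := by
  have h : Summable fun n : ℕ => Real.exp (-(n : ℝ)) := Real.summable_exp_neg_nat
  exact Summable.of_nat_of_neg (by simpa using h) (by simpa using h)

lemma summable_pi_prod {α : Type*} {f : α → ℝ} (hf : Summable f) (hf0 : ∀ a, 0 ≤ f a) :
    ∀ g : ℕ, Summable fun m : Fin g → α => ∏ j, f (m j)
  | 0 => (hasSum_fintype _).summable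
  | g + 1 => by
    have h := hf.mul_of_nonneg (summable_pi_prod hf hf0 g) hf0
      fun m => Finset.prod_nonneg fun j _ => hf0 (m j)
    rw [← (Fin.consEquiv fun _ : Fin (g + 1) => α).summable_iff]
    refine h.congr fun x => ?_
    simp [Fin.prod_univ_succ, Fin.consEquiv]

lemma Matrix.PosDef.exists_pos_mul_sum_sq_le {Y : Matrix (Fin g) (Fin g) ℝ} (hY : Y.PosDef) :
    ∃ c > 0, ∀ x : Fin g → ℝ, c * ∑ j, x j ^ 2 ≤ x ⬝ᵥ Y *ᵥ x := by
  set K : Set (Fin g → ℝ) := {x | ∑ j, x j ^ 2 = 1}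
  have hK : IsCompact K := by
    refine Metric.isCompact_of_isClosed_isBounded
      (isClosed_eq (by fun_prop) continuous_const) ?_
    refine (Metric.isBounded_closedBall (x := (0 : Fin g → ℝ)) (r := 1)).subset fun x hx => ?_
    rw [mem_closedBall_zero_iff, pi_norm_le_iff_of_nonneg zero_le_one]
    intro j
    have h1 : x j ^ 2 ≤ ∑ j, x j ^ 2 :=
      Finset.single_le_sum (f := fun j => x j ^ 2) (fun j _ => sq_nonneg _) (Finset.mem_univ j)
    rw [show ∑ j, x j ^ 2 = 1 from hx] at h1
    exact (sq_le_one_iff_abs_le_one _).mp h1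
  have hpos : ∀ x : Fin g → ℝ, x ≠ 0 → 0 < x ⬝ᵥ Y *ᵥ x := fun x hx => by
    simpa using hY.dotProduct_mulVec_pos hx
  have hcont : Continuous fun x : Fin g → ℝ => x ⬝ᵥ Y *ᵥ x := by fun_prop
  obtain ⟨c, hc, hcK⟩ : ∃ c > 0, ∀ x ∈ K, c ≤ x ⬝ᵥ Y *ᵥ x := by
    rcases K.eq_empty_or_nonempty with h | h
    · exact ⟨1, one_pos, by simp [h]⟩
    · obtain ⟨x₀, hx₀, hmin⟩ := hK.exists_isMinOn h hcont.continuousOn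
      refine ⟨_, hpos x₀ ?_, fun x hx => hmin hx⟩
      rintro rfl
      simp [K] at hx₀
  refine ⟨c, hc, fun x => ?_⟩
  have hs0 : 0 ≤ ∑ j, x j ^ 2 := Finset.sum_nonneg fun j _ => sq_nonneg _
  rcases hs0.eq_or_lt with h0 | h0
  · have hx : x = 0 := by
      rw [eq_comm, Finset.sum_eq_zero_iff_of_nonneg fun j _ => sq_nonneg _] at h0
      ext j
      simpa using h0 j (Finset.mem_univ j)
    simp [hx]
  · set s := Real.sqrt (∑ j, x j ^ 2)
    have hs : 0 < s := Real.sqrt_pos.mpr h0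
    have hs2 : s ^ 2 = ∑ j, x j ^ 2 := Real.sq_sqrt hs0
    have h := hcK (s⁻¹ • x) (by
      simp only [K, Set.mem_ofPred_eq, Pi.smul_apply, smul_eq_mul, mul_pow, ← Finset.mul_sum]
      rw [← hs2]
      field_simp)
    rw [mulVec_smul, smul_dotProduct, dotProduct_smul, smul_eq_mul, smul_eq_mul] at h
    rw [← hs2]
    calc c * s ^ 2 ≤ s⁻¹ * (s⁻¹ * (x ⬝ᵥ Y *ᵥ x)) * s ^ 2 := by gcongr
      _ = _ := by field_simp

/-- The Gaussian `exp (πi x·τx)`. -/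
def gauss (τ : Matrix (Fin g) (Fin g) ℂ) (x : Fin g → ℂ) : ℂ :=
  cexp (Real.pi * I * (x ⬝ᵥ τ *ᵥ x))

/-- The inclusion of integer vectors in complex vectors. -/
def intVec (m : Fin g → ℤ) : Fin g → ℂ := fun j => m j

@[simp] lemma intVec_apply (m : Fin g → ℤ) (j : Fin g) : intVec m j = m j := rfl

@[simp] lemma intVec_zero : intVec (0 : Fin g → ℤ) = 0 := by ext; simp

@[simp] lemma intVec_add (m n : Fin g → ℤ) : intVec (m + n) = intVec m + intVec n := by
  ext; simp

@[simp] lemma intVec_neg (m : Fin g → ℤ) : intVec (-m) = -intVec m := by ext; simp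

@[simp] lemma intVec_sub (m n : Fin g → ℤ) : intVec (m - n) = intVec m - intVec n := by
  ext; simp

lemma norm_gauss_ofReal (τ : Matrix (Fin g) (Fin g) ℂ) (x : Fin g → ℝ) :
    ‖gauss τ fun j => (x j : ℂ)‖ =
      Real.exp (-Real.pi * (x ⬝ᵥ (Matrix.of fun i j => (τ i j).im) *ᵥ x)) := by
  rw [gauss, Complex.norm_exp]
  congr 1
  have h : ((fun j => (x j : ℂ)) ⬝ᵥ τ *ᵥ fun j => (x j : ℂ)).im =
      x ⬝ᵥ (Matrix.of fun i j => (τ i j).im) *ᵥ x := by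
    simp [dotProduct, mulVec, Complex.im_sum]
  rw [← h]
  simp [Complex.mul_re, Complex.mul_im]

lemma rapidDecay_gauss {τ : Matrix (Fin g) (Fin g) ℂ} (hτ : IsSiegel τ) (y : Fin g → ℝ) :
    RapidDecay (fun (m : Fin g → ℤ) => intVec m + fun j => (y j : ℂ))
      (fun m => gauss τ (intVec m + fun j => (y j : ℂ))) := by
  obtain ⟨c, hc, hY⟩ := hτ.2.exists_pos_mul_sum_sq_le
  intro R
  set C := Real.pi * c
  have hC : 0 < C := by positivity
  set K : ℝ := (R + 1) ^ 2 / (4 * C)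
  refine Summable.of_nonneg_of_le (fun m => by positivity) (fun m => ?_)
    ((summable_pi_prod summable_exp_neg_abs_int (fun _ => (Real.exp_pos _).le) g).mul_left
      (Real.exp (∑ j, (K + |y j|))))
  have hx : (intVec m + fun j => (y j : ℂ)) = fun j => ((m j + y j : ℝ) : ℂ) := by
    ext j; simp
  beta_reduce
  rw [hx, norm_gauss_ofReal, ← Real.exp_sum, ← Real.exp_add, ← Real.exp_add]
  refine Real.exp_le_exp.mpr ?_
  have h1 := mul_le_mul_of_nonneg_left (hY fun j => m j + y j) Real.pi_pos.le
  have h2 : ∀ t : ℝ, R * |t| - C * t ^ 2 ≤ K - |t| := fun t => by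
    have hK : K * (4 * C) = (R + 1) ^ 2 := by simp only [K]; field_simp
    have := sq_nonneg (2 * C * |t| - (R + 1))
    have h3 : |t| ^ 2 = t ^ 2 := sq_abs t
    rw [← h3]
    by_contra! hlt
    nlinarith [mul_lt_mul_of_pos_right hlt (show 0 < 4 * C by positivity)]
  have h4 : ∀ j, R * |m j + y j| - C * (m j + y j) ^ 2 ≤ K + |y j| + -|(m j : ℝ)| := fun j => by
    have h5 : |(m j : ℝ)| ≤ |m j + y j| + |y j| := by
      simpa using abs_sub (m j + y j : ℝ) (y j)
    linarith [h2 (m j + y j)]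
  have h6 := Finset.sum_le_sum fun j (_ : j ∈ Finset.univ) => h4 j
  rw [Finset.sum_sub_distrib, ← Finset.mul_sum, ← Finset.mul_sum,
    Finset.sum_add_distrib] at h6
  simp only [Complex.norm_real, Real.norm_eq_abs, Complex.norm_intCast]
  simp only [C] at h6
  linarith

lemma rapidDecay_gauss_int {τ : Matrix (Fin g) (Fin g) ℂ} (hτ : IsSiegel τ) :
    RapidDecay intVec (fun m => gauss τ (intVec m)) := by
  have h := rapidDecay_gauss hτ 0
  have h0 : (fun j : Fin g => (((0 : Fin g → ℝ) j : ℝ) : ℂ)) = 0 := by ext; simp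
  simpa only [h0, add_zero] using h

end Gauss

section Inversion

variable {g : ℕ}

lemma sum_fin_cexp_eq_ite (N : ℕ) [NeZero N] (k : ℤ) :
    ∑ x : Fin N, cexp (2 * Real.pi * I * (k * ((x : ℕ) : ℂ) / N)) =
      if (N : ℤ) ∣ k then (N : ℂ) else 0 := by
  have hN : (N : ℂ) ≠ 0 := Nat.cast_ne_zero.mpr (NeZero.ne N)
  set ζ : ℂ := cexp (2 * Real.pi * I * (k / N)) with hζ
  have hterm : ∀ x : ℕ, cexp (2 * Real.pi * I * (k * (x : ℂ) / N)) = ζ ^ x := fun x => by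
    rw [hζ, ← Complex.exp_nat_mul]
    congr 1
    ring
  simp only [hterm]
  rw [Fin.sum_univ_eq_sum_range (fun x => ζ ^ x) N]
  have hpow : ζ ^ N = 1 := by
    rw [← hterm, mul_div_assoc, div_self hN, mul_one, mul_comm]
    exact Complex.exp_int_mul_two_pi_mul_I k
  have hone : ζ = 1 ↔ (N : ℤ) ∣ k := by
    rw [hζ, Complex.exp_eq_one_iff]
    constructor
    · rintro ⟨n, hn⟩
      refine ⟨n, ?_⟩
      have h2 : (k : ℂ) / N = n := by
        have := Complex.two_pi_I_ne_zero
        apply mul_left_cancel₀ this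
        rw [hn]
        ring
      rw [div_eq_iff hN] at h2
      have h3 : (k : ℂ) = ((N * n : ℤ) : ℂ) := by
        push_cast
        rw [h2, mul_comm]
      exact_mod_cast h3
    · rintro ⟨n, rfl⟩
      refine ⟨n, ?_⟩
      push_cast
      field_simp
  split_ifs with h
  · simp [hone.mpr h]
  · have := geom_sum_mul ζ N
    rw [hpow, sub_self] at this
    exact (mul_eq_zero.mp this).resolve_right (sub_ne_zero.mpr (mt hone.mp h))

lemma sum_pi_cexp_eq_ite (N : ℕ) [NeZero N] (m : Fin g → ℤ) :
    ∑ x : Fin g → Fin N, cexp (2 * Real.pi * I * (intVec m ⬝ᵥ fun j => ((x j : ℕ) : ℂ) / N)) =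
      if ∀ j, (N : ℤ) ∣ m j then (N : ℂ) ^ g else 0 := by
  have h := Finset.prod_univ_sum (fun _ : Fin g => (Finset.univ : Finset (Fin N)))
    (fun j x => cexp (2 * Real.pi * I * (m j * ((x : ℕ) : ℂ) / N)))
  simp only [sum_fin_cexp_eq_ite, Fintype.piFinset_univ] at h
  rw [Finset.prod_ite_zero] at h
  simp only [Finset.mem_univ, true_imp_iff, Finset.prod_const, Finset.card_univ,
    Fintype.card_fin] at h
  rw [h]
  refine Finset.sum_congr rfl fun x _ => ?_
  rw [← Complex.exp_sum, ← Finset.mul_sum]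
  congr 2
  exact Finset.sum_congr rfl fun j _ => by simp [mul_div_assoc]

/-- If the finite Fourier transform modulo `N` of a summable family vanishes, then so do its
sums over residue classes modulo `N`. -/
lemma tsum_residue_class_eq_zero {A : (Fin g → ℤ) → ℂ} (hA : Summable fun m => ‖A m‖)
    (N : ℕ) [NeZero N]
    (h : ∀ x : Fin g → Fin N,
      ∑' m, A m * cexp (2 * Real.pi * I * (intVec m ⬝ᵥ fun j => ((x j : ℕ) : ℂ) / N)) = 0)
    (q : Fin g → ℤ) :
    ∑' m : Fin g → ℤ, (if ∀ j, (N : ℤ) ∣ m j - q j then A m else 0) = 0 := by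
  set e : (Fin g → ℤ) → (Fin g → Fin N) → ℂ := fun m x =>
    cexp (2 * Real.pi * I * (intVec m ⬝ᵥ fun j => ((x j : ℕ) : ℂ) / N))
  have hnorm : ∀ m x, ‖e m x‖ = 1 := fun m x => by
    have : 2 * Real.pi * I * (intVec m ⬝ᵥ fun j => ((x j : ℕ) : ℂ) / N) =
        ((2 * Real.pi * ∑ j, (m j : ℝ) * (((x j : ℕ) : ℝ) / N) : ℝ) : ℂ) * I := by
      simp only [dotProduct, intVec_apply]
      push_cast
      ring
    simp only [e, this, Complex.norm_exp_ofReal_mul_I]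
  have hsum : ∀ x ∈ (Finset.univ : Finset (Fin g → Fin N)),
      Summable fun m => A m * e (m - q) x := fun x _ => by
    refine Summable.of_norm (hA.congr fun m => ?_)
    rw [norm_mul, hnorm, mul_one]
  have key := Summable.tsum_finsetSum hsum
  have hzero : ∀ x, ∑' m, A m * e (m - q) x = 0 := fun x => by
    have : ∀ m, A m * e (m - q) x = A m * e m x * e (-q) x := fun m => by
      rw [mul_assoc, ← Complex.exp_add]
      simp only [e, intVec_sub, intVec_neg, sub_dotProduct, neg_dotProduct]
      congr 2
      ring
    simp only [this]
    rw [tsum_mul_right, h x, zero_mul]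
  simp only [hzero, Finset.sum_const_zero, ← Finset.mul_sum] at key
  simp only [e, sum_pi_cexp_eq_ite, Pi.sub_apply] at key
  have hN : (N : ℂ) ^ g ≠ 0 := pow_ne_zero _ (Nat.cast_ne_zero.mpr (NeZero.ne N))
  refine (mul_eq_zero.mp ?_).resolve_right hN
  rw [← tsum_mul_right]
  exact (tsum_congr fun m => by split_ifs <;> simp).trans key

/-- An exponential series with integer frequencies that vanishes identically has vanishing
constant term. -/
lemma RapidDecay.coeff_zero_eq_zero {p : (Fin g → ℤ) → ℂ} (hp : RapidDecay intVec p)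
    (h : ∀ z, expSeries intVec p z = 0) : p 0 = 0 := by
  have hA : Summable fun m => ‖p m‖ := by simpa using hp 0
  have hlim := tendsto_tsum_of_dominated_convergence (𝓕 := atTop) (bound := fun m => ‖p m‖)
    (f := fun (N : ℕ) (m : Fin g → ℤ) => if ∀ j, ((N + 1 : ℕ) : ℤ) ∣ m j then p m else 0)
    (g := fun m => if m = 0 then p m else 0) hA
    (fun m => by
      refine tendsto_const_nhds.congr' ?_
      by_cases hm : m = 0
      · simp [hm]
      · obtain ⟨j, hj⟩ := Function.ne_iff.mp hm
        filter_upwards [eventually_ge_atTop (m j).natAbs] with N hN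
        rw [if_neg hm, if_neg]
        intro hdvd
        have := Nat.le_of_dvd (Int.natAbs_pos.mpr hj) (Int.natCast_dvd.mp (hdvd j))
        omega)
    (Eventually.of_forall fun N m => by split_ifs <;> simp)
  have hzero : ∀ N : ℕ,
      ∑' m : Fin g → ℤ, (if ∀ j, ((N + 1 : ℕ) : ℤ) ∣ m j then p m else 0) = 0 := fun N => by
    simpa using tsum_residue_class_eq_zero hA (N + 1) (fun x => h _) 0
  simp only [hzero] at hlim
  have := tendsto_nhds_unique hlim tendsto_const_nhds
  rwa [tsum_ite_eq] at this

end Inversion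

section RiemannTheta

variable {g : ℕ} {τ : Matrix (Fin g) (Fin g) ℂ}

/-- The Riemann theta function `∑ exp (πi m·τm + 2πi m·z)`. -/
def riemannTheta (τ : Matrix (Fin g) (Fin g) ℂ) : (Fin g → ℂ) → ℂ :=
  expSeries intVec fun m => gauss τ (intVec m)

/-- The derivative of the Riemann theta function in the direction `v`. -/
def riemannThetaDeriv (τ : Matrix (Fin g) (Fin g) ℂ) (v : Fin g → ℂ) : (Fin g → ℂ) → ℂ :=
  expSeries intVec fun m => gauss τ (intVec m) * (2 * Real.pi * I * (intVec m ⬝ᵥ v))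

lemma dotProduct_mulVec_symm (hτ : τ.IsSymm) (x y : Fin g → ℂ) :
    x ⬝ᵥ τ *ᵥ y = y ⬝ᵥ τ *ᵥ x := by
  rw [dotProduct_mulVec, ← mulVec_transpose, hτ.eq, dotProduct_comm]

lemma expSeries_add_intVec (p : (Fin g → ℤ) → ℂ) (z : Fin g → ℂ) (n : Fin g → ℤ) :
    expSeries intVec p (z + intVec n) = expSeries intVec p z := by
  refine tsum_congr fun m => ?_
  have h : intVec m ⬝ᵥ intVec n = ((m ⬝ᵥ n : ℤ) : ℂ) := by simp [dotProduct]
  rw [dotProduct_add, h, mul_add, Complex.exp_add, mul_comm _ ((m ⬝ᵥ n : ℤ) : ℂ),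
    Complex.exp_int_mul_two_pi_mul_I, mul_one]

lemma gauss_mul_cexp_add_mulVec (hτ : τ.IsSymm) (x y z : Fin g → ℂ) :
    gauss τ y * cexp (2 * Real.pi * I * (y ⬝ᵥ z)) *
      (gauss τ x * cexp (2 * Real.pi * I * (x ⬝ᵥ (z + τ *ᵥ y)))) =
    gauss τ (x + y) * cexp (2 * Real.pi * I * ((x + y) ⬝ᵥ z)) := by
  simp only [gauss, ← Complex.exp_add, dotProduct_add, add_dotProduct, mulVec_add]
  rw [dotProduct_mulVec_symm hτ y x]
  congr 1
  ring

lemma riemannTheta_add_mulVec (hτ : IsSiegel τ) (z : Fin g → ℂ) (n : Fin g → ℤ) :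
    gauss τ (intVec n) * cexp (2 * Real.pi * I * (intVec n ⬝ᵥ z)) *
      riemannTheta τ (z + τ *ᵥ intVec n) = riemannTheta τ z := by
  simp only [riemannTheta, expSeries]
  rw [← tsum_mul_left]
  refine Eq.trans (tsum_congr fun m => ?_) ((Equiv.addRight n).tsum_eq _)
  rw [gauss_mul_cexp_add_mulVec hτ.1, Equiv.coe_addRight, intVec_add]

lemma riemannThetaDeriv_add_mulVec (hτ : IsSiegel τ) (v z : Fin g → ℂ) (n : Fin g → ℤ) :
    gauss τ (intVec n) * cexp (2 * Real.pi * I * (intVec n ⬝ᵥ z)) *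
      riemannThetaDeriv τ v (z + τ *ᵥ intVec n) =
    riemannThetaDeriv τ v z - 2 * Real.pi * I * (intVec n ⬝ᵥ v) * riemannTheta τ z := by
  have h1 := ((rapidDecay_gauss_int hτ).mul_dotProduct v).summable_norm z |>.of_norm
  have h2 := (rapidDecay_gauss_int hτ).summable_norm z |>.of_norm
  simp only [riemannTheta, riemannThetaDeriv, expSeries]
  rw [← tsum_mul_left, ← tsum_mul_left, ← h1.tsum_sub (h2.mul_left _)]
  refine Eq.trans (tsum_congr fun m => ?_) ((Equiv.addRight n).tsum_eq _)
  have h := gauss_mul_cexp_add_mulVec hτ.1 (intVec m) (intVec n) z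
  rw [Equiv.coe_addRight, intVec_add]
  calc _ = gauss τ (intVec n) * cexp (2 * Real.pi * I * (intVec n ⬝ᵥ z)) *
      (gauss τ (intVec m) * cexp (2 * Real.pi * I * (intVec m ⬝ᵥ (z + τ *ᵥ intVec n)))) *
      (2 * Real.pi * I * (intVec m ⬝ᵥ v)) := by ring
    _ = _ := by
      rw [h, add_dotProduct (intVec m) (intVec n) v]
      ring

lemma hasSum_mul_four {V : Type*} {f₁ f₂ f₃ f₄ : V → ℂ} (h₁ : Summable fun i => ‖f₁ i‖)
    (h₂ : Summable fun i => ‖f₂ i‖) (h₃ : Summable fun i => ‖f₃ i‖)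
    (h₄ : Summable fun i => ‖f₄ i‖) :
    HasSum (fun x : (V × V) × V × V => f₁ x.1.1 * f₂ x.1.2 * (f₃ x.2.1 * f₄ x.2.2))
      ((∑' i, f₁ i) * (∑' i, f₂ i) * ((∑' i, f₃ i) * ∑' i, f₄ i)) := by
  have h₁₂ := h₁.mul_norm h₂
  have h₃₄ := h₃.mul_norm h₄
  rw [tsum_mul_tsum_of_summable_norm h₁ h₂, tsum_mul_tsum_of_summable_norm h₃ h₄,
    tsum_mul_tsum_of_summable_norm h₁₂ h₃₄]
  exact (h₁₂.mul_norm h₃₄).of_norm.hasSum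

/-- The parametrisation of quadruples by their last entry and their differences to it. -/
def quadrupleEquiv (V : Type*) [AddCommGroup V] : ((V × V) × V) × V ≃ (V × V) × V × V where
  toFun x := ((x.1.1.1 + x.2, x.1.1.2 + x.2), (x.1.2 + x.2, x.2))
  invFun y := (((y.1.1 - y.2.2, y.1.2 - y.2.2), y.2.1 - y.2.2), y.2.2)
  left_inv x := by simp
  right_inv y := by simp

lemma quartic_relation (hτ : IsSiegel τ) {v : Fin g → ℂ}
    (hv : ∀ r : Fin g → ℤ, ∑' k : Fin g → ℤ,
      gauss τ ((2 : ℂ)⁻¹ • (intVec r + (4 : ℂ) • intVec k)) *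
        ((intVec r + (4 : ℂ) • intVec k) ⬝ᵥ v) = 0)
    {a b c d : Fin g → ℂ} (habcd : a + b + c + d = 0) :
    riemannThetaDeriv τ v a * riemannTheta τ b * (riemannTheta τ c * riemannTheta τ d) +
      riemannTheta τ a * riemannThetaDeriv τ v b * (riemannTheta τ c * riemannTheta τ d) +
      riemannTheta τ a * riemannTheta τ b * (riemannThetaDeriv τ v c * riemannTheta τ d) +
      riemannTheta τ a * riemannTheta τ b * (riemannTheta τ c * riemannThetaDeriv τ v d) = 0 := by
  have t := (rapidDecay_gauss_int hτ).summable_norm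
  have s := ((rapidDecay_gauss_int hτ).mul_dotProduct v).summable_norm
  have h := (((hasSum_mul_four (s a) (t b) (t c) (t d)).add
    (hasSum_mul_four (t a) (s b) (t c) (t d))).add
    (hasSum_mul_four (t a) (t b) (s c) (t d))).add (hasSum_mul_four (t a) (t b) (t c) (s d))
  rw [← (quadrupleEquiv (Fin g → ℤ)).hasSum_iff] at h
  refine (h.prod_fiberwise fun n => (h.summable.prod_factor n).hasSum).unique ?_
  convert hasSum_zero with n
  set r := n.1.1 + n.1.2 + n.2 with hr
  refine Eq.trans (tsum_congr fun k => ?_)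
    ((tsum_mul_left (a := 2 * Real.pi * I *
      cexp (Real.pi * I * (intVec n.1.1 ⬝ᵥ τ *ᵥ intVec n.1.1 +
        intVec n.1.2 ⬝ᵥ τ *ᵥ intVec n.1.2 + intVec n.2 ⬝ᵥ τ *ᵥ intVec n.2 -
        intVec r ⬝ᵥ τ *ᵥ intVec r / 4) + 2 * Real.pi * I *
        (intVec n.1.1 ⬝ᵥ a + intVec n.1.2 ⬝ᵥ b + intVec n.2 ⬝ᵥ c)))).trans
    (by rw [hv r, mul_zero]))
  obtain rfl : d = -(a + b + c) := by rw [eq_neg_iff_add_eq_zero, ← habcd]; abel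
  simp only [Function.comp, quadrupleEquiv, Equiv.coe_fn_mk, intVec_add]
  have hexp : gauss τ (intVec n.1.1 + intVec k) *
        cexp (2 * Real.pi * I * ((intVec n.1.1 + intVec k) ⬝ᵥ a)) *
      (gauss τ (intVec n.1.2 + intVec k) *
        cexp (2 * Real.pi * I * ((intVec n.1.2 + intVec k) ⬝ᵥ b))) *
      ((gauss τ (intVec n.2 + intVec k) *
        cexp (2 * Real.pi * I * ((intVec n.2 + intVec k) ⬝ᵥ c))) *
      (gauss τ (intVec k) * cexp (2 * Real.pi * I * (intVec k ⬝ᵥ -(a + b + c))))) =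
      cexp (Real.pi * I * (intVec n.1.1 ⬝ᵥ τ *ᵥ intVec n.1.1 +
        intVec n.1.2 ⬝ᵥ τ *ᵥ intVec n.1.2 + intVec n.2 ⬝ᵥ τ *ᵥ intVec n.2 -
        intVec r ⬝ᵥ τ *ᵥ intVec r / 4) + 2 * Real.pi * I *
        (intVec n.1.1 ⬝ᵥ a + intVec n.1.2 ⬝ᵥ b + intVec n.2 ⬝ᵥ c)) *
      gauss τ ((2 : ℂ)⁻¹ • (intVec r + (4 : ℂ) • intVec k)) := by
    simp only [gauss, ← Complex.exp_add, hr, intVec_add, dotProduct_add, add_dotProduct,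
      mulVec_add, mulVec_smul, smul_dotProduct, dotProduct_smul, smul_eq_mul, dotProduct_neg]
    rw [dotProduct_mulVec_symm hτ.1 (intVec k) (intVec n.1.1),
      dotProduct_mulVec_symm hτ.1 (intVec k) (intVec n.1.2),
      dotProduct_mulVec_symm hτ.1 (intVec k) (intVec n.2)]
    congr 1
    ring
  have hlin : (intVec r + (4 : ℂ) • intVec k) ⬝ᵥ v =
      (intVec n.1.1 + intVec k) ⬝ᵥ v + (intVec n.1.2 + intVec k) ⬝ᵥ v +
      (intVec n.2 + intVec k) ⬝ᵥ v + intVec k ⬝ᵥ v := by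
    simp only [hr, intVec_add, add_dotProduct, smul_dotProduct, smul_eq_mul]
    ring
  rw [hlin]
  linear_combination (2 * Real.pi * I * ((intVec n.1.1 + intVec k) ⬝ᵥ v +
    (intVec n.1.2 + intVec k) ⬝ᵥ v + (intVec n.2 + intVec k) ⬝ᵥ v + intVec k ⬝ᵥ v)) * hexp

end RiemannTheta

section LogDerivative

variable {E : Type*} [NormedAddCommGroup E] [NormedSpace ℂ E]

lemma Differentiable.dense_ne_zero {f : E → ℂ} (hf : Differentiable ℂ f) (h : ∃ z, f z ≠ 0) :
    Dense {z | f z ≠ 0} := by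
  obtain ⟨z, hz⟩ := h
  by_contra hd
  obtain ⟨a, ha⟩ : ∃ a, a ∉ closure {z | f z ≠ 0} := by
    simpa [Dense] using hd
  set φ : ℂ → ℂ := fun s => f (a + s • (z - a)) with hφ
  have hφd : Differentiable ℂ φ := by fun_prop
  have hev : ∀ᶠ s in 𝓝 (0 : ℂ), φ s = 0 := by
    have hcont : ContinuousAt (fun s : ℂ => a + s • (z - a)) 0 := by fun_prop
    have hmem : (closure {z | f z ≠ 0})ᶜ ∈ 𝓝 (a + (0 : ℂ) • (z - a)) := by
      rw [zero_smul, add_zero]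
      exact isClosed_closure.isOpen_compl.mem_nhds ha
    filter_upwards [hcont.preimage_mem_nhds hmem] with s hs
    by_contra hne
    exact hs (subset_closure hne)
  have hzero := AnalyticOnNhd.eqOn_zero_of_preconnected_of_eventuallyEq_zero
    (fun s _ => hφd.analyticAt s) isPreconnected_univ (Set.mem_univ 0) hev (Set.mem_univ 1)
  simp [hφ, hz] at hzero

/-- A function `D / θ` whose values at any four points with sum zero add up to zero has
increments that are additive in the step. -/
lemma exists_addMonoidHom_of_quartic {θ D : E → ℂ} (hθ : Differentiable ℂ θ)
    (hne : ∃ z, θ z ≠ 0)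
    (hquartic : ∀ a b c d, a + b + c + d = 0 →
      D a * θ b * (θ c * θ d) + θ a * D b * (θ c * θ d) + θ a * θ b * (D c * θ d) +
        θ a * θ b * (θ c * D d) = 0) :
    ∃ l : E →+ ℂ, ∀ a w, θ a ≠ 0 → θ (a + w) ≠ 0 → l w = D (a + w) / θ (a + w) - D a / θ a := by
  have hdense := hθ.dense_ne_zero hne
  have hopen : IsOpen {z | θ z ≠ 0} := isOpen_ne_fun hθ.continuous continuous_const
  have hpair : ∀ e : E ≃ₜ E, Dense {z | θ z ≠ 0 ∧ θ (e z) ≠ 0} := fun e =>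
    hdense.inter_of_isOpen_left (hdense.preimage e.isOpenMap) hopen
  have hsum : ∀ a b c d, a + b + c + d = 0 → θ a ≠ 0 → θ b ≠ 0 → θ c ≠ 0 → θ d ≠ 0 →
      D a / θ a + D b / θ b + D c / θ c + D d / θ d = 0 := fun a b c d h ha hb hc hd => by
    have := hquartic a b c d h
    field_simp
    linear_combination this
  have hstep : ∀ w a b, θ a ≠ 0 → θ (a + w) ≠ 0 → θ b ≠ 0 → θ (b + w) ≠ 0 →
      D (a + w) / θ (a + w) - D a / θ a = D (b + w) / θ (b + w) - D b / θ b := by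
    intro w a b ha haw hb hbw
    obtain ⟨c, hc, hd⟩ := (hpair (Homeomorph.subLeft (-(a + b + w)))).nonempty
    simp only [Homeomorph.coe_subLeft] at hd
    have h1 := hsum (a + w) b c (-(a + b + w) - c) (by abel) haw hb hc hd
    have h2 := hsum a (b + w) c (-(a + b + w) - c) (by abel) ha hbw hc hd
    linear_combination h1 - h2
  have hex : ∀ w, ∃ a, θ a ≠ 0 ∧ θ (a + w) ≠ 0 := fun w =>
    (hpair (Homeomorph.addRight w)).nonempty
  choose a₀ ha₀ ha₀w using hex
  refine ⟨AddMonoidHom.mk' (fun w => D (a₀ w + w) / θ (a₀ w + w) - D (a₀ w) / θ (a₀ w))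
    fun w w' => ?_, fun a w ha haw => hstep w _ _ (ha₀ w) (ha₀w w) ha haw⟩
  obtain ⟨a, haww, ha, haw⟩ := ((hdense.preimage (Homeomorph.addRight (w + w')).isOpenMap
    ).inter_of_isOpen_left (hpair (Homeomorph.addRight w)) (hopen.preimage
      (Homeomorph.addRight (w + w')).continuous)).nonempty
  simp only [Homeomorph.coe_addRight, Set.mem_preimage, Set.mem_ofPred_eq, ← add_assoc] at haww haw
  rw [hstep (w + w') _ a (ha₀ _) (ha₀w _) ha (by rwa [← add_assoc]),
    hstep w _ a (ha₀ _) (ha₀w _) ha haw, hstep w' _ (a + w) (ha₀ _) (ha₀w _) haw haww, add_assoc]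
  ring

lemma AddMonoidHom.eq_zero_of_hasDerivAt {φ : ℂ →+ ℂ} {c : ℂ} (hφ : HasDerivAt φ c 0)
    (h1 : φ 1 = 0) (s : ℂ) : φ s = 0 := by
  have hlim : ∀ s : ℂ, s ≠ 0 → φ s = c * s := fun s hs => by
    have hseq : Tendsto (fun n : ℕ => s / ((n : ℂ) + 1)) atTop (𝓝[≠] 0) := by
      refine tendsto_nhdsWithin_iff.mpr ⟨?_, Eventually.of_forall fun n => ?_⟩
      · have := (tendsto_one_div_add_atTop_nhds_zero_nat (𝕜 := ℂ)).const_mul s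
        simpa [div_eq_mul_inv] using this
      · exact div_ne_zero hs (Nat.cast_add_one_ne_zero n)
    have h := (hasDerivAt_iff_tendsto_slope.mp hφ).comp hseq
    have hconst : ∀ n : ℕ, (slope φ 0 ∘ fun n : ℕ => s / ((n : ℂ) + 1)) n = φ s / s := fun n => by
      have hn : (n : ℂ) + 1 ≠ 0 := Nat.cast_add_one_ne_zero n
      have hmul : φ s = (n + 1 : ℕ) • φ (s / ((n : ℂ) + 1)) := by
        rw [← map_nsmul, nsmul_eq_mul]
        congr 1
        push_cast
        field_simp
      simp only [Function.comp, slope_def_field, map_zero, sub_zero]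
      rw [hmul, nsmul_eq_mul]
      push_cast
      field_simp
    rw [← div_eq_iff hs]
    exact tendsto_nhds_unique (tendsto_const_nhds.congr fun n => (hconst n).symm) h
  rcases eq_or_ne s 0 with rfl | hs
  · exact map_zero φ
  · have := hlim 1 one_ne_zero
    rw [h1, mul_one] at this
    rw [hlim s hs, ← this, zero_mul]

end LogDerivative

section Span

variable {g : ℕ} {τ : Matrix (Fin g) (Fin g) ℂ}

lemma exists_riemannTheta_ne_zero (hτ : IsSiegel τ) : ∃ z, riemannTheta τ z ≠ 0 := by
  by_contra! h
  have := (rapidDecay_gauss_int hτ).coeff_zero_eq_zero h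
  simp [gauss] at this

lemma eq_zero_of_tsum_gauss_eq_zero (hτ : IsSiegel τ) {v : Fin g → ℂ}
    (hv : ∀ r : Fin g → ℤ, ∑' k : Fin g → ℤ,
      gauss τ ((2 : ℂ)⁻¹ • (intVec r + (4 : ℂ) • intVec k)) *
        ((intVec r + (4 : ℂ) • intVec k) ⬝ᵥ v) = 0) : v = 0 := by
  have hθ : Differentiable ℂ (riemannTheta τ) := (rapidDecay_gauss_int hτ).differentiable
  have hD : Differentiable ℂ (riemannThetaDeriv τ v) :=
    ((rapidDecay_gauss_int hτ).mul_dotProduct v).differentiable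
  obtain ⟨a, ha⟩ := exists_riemannTheta_ne_zero hτ
  obtain ⟨l, hl⟩ := exists_addMonoidHom_of_quartic hθ ⟨a, ha⟩
    fun a b c d h => quartic_relation hτ hv h
  have hunit : ∀ j : Fin g, (Pi.single j 1 : Fin g → ℂ) = intVec (Pi.single j 1) := fun j => by
    ext i
    by_cases h : i = j
    · subst h; simp
    · simp [h]
  have hcoord : ∀ (j : Fin g) (s : ℂ), l (Pi.single j s) = 0 := fun j s => by
    set φ : ℂ →+ ℂ := l.comp (AddMonoidHom.single (fun _ : Fin g => ℂ) j)
    have hsingle : ∀ s : ℂ, (Pi.single j s : Fin g → ℂ) = s • Pi.single j (1 : ℂ) := fun s => by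
      rw [← Pi.single_smul, smul_eq_mul, mul_one]
    set γ : ℂ → Fin g → ℂ := fun s => a + s • Pi.single j (1 : ℂ) with hγ
    have hγ0 : γ 0 = a := by simp [hγ]
    have hγd : Differentiable ℂ γ := by fun_prop
    have hθγ : Differentiable ℂ fun s => riemannTheta τ (γ s) := hθ.comp hγd
    have hDγ : Differentiable ℂ fun s => riemannThetaDeriv τ v (γ s) := hD.comp hγd
    have hne0 : riemannTheta τ (γ 0) ≠ 0 := by rwa [hγ0]
    have hev : φ =ᶠ[𝓝 0] fun s => riemannThetaDeriv τ v (γ s) / riemannTheta τ (γ s) -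
        riemannThetaDeriv τ v a / riemannTheta τ a := by
      filter_upwards [hθγ.continuous.continuousAt.eventually_ne hne0] with s hs
      have := hl a (s • Pi.single j 1) ha hs
      rw [← this, ← hsingle]
      rfl
    have hd : DifferentiableAt ℂ φ 0 :=
      (((hDγ 0).div (hθγ 0) hne0).sub_const _).congr_of_eventuallyEq hev
    refine AddMonoidHom.eq_zero_of_hasDerivAt hd.hasDerivAt ?_ s
    have hshift := expSeries_add_intVec (g := g)
    have h1 : riemannTheta τ (a + Pi.single j 1) = riemannTheta τ a := by
      rw [hunit]; exact hshift _ _ _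
    have h2 : riemannThetaDeriv τ v (a + Pi.single j 1) = riemannThetaDeriv τ v a := by
      rw [hunit]; exact hshift _ _ _
    have := hl a (Pi.single j 1) ha (by rwa [h1])
    rw [h1, h2, sub_self] at this
    exact this
  have hl0 : ∀ w, l w = 0 := fun w => by
    rw [← Finset.univ_sum_single w, map_sum]
    exact Finset.sum_eq_zero fun j _ => hcoord j _
  ext j
  set n : Fin g → ℤ := Pi.single j 1
  have hθn := riemannTheta_add_mulVec hτ a n
  have hDn := riemannThetaDeriv_add_mulVec hτ v a n
  set C := gauss τ (intVec n) * cexp (2 * Real.pi * I * (intVec n ⬝ᵥ a))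
  have hC : C ≠ 0 := mul_ne_zero (Complex.exp_ne_zero _) (Complex.exp_ne_zero _)
  have hne : riemannTheta τ (a + τ *ᵥ intVec n) ≠ 0 := by
    intro h
    rw [h, mul_zero] at hθn
    exact ha hθn.symm
  have h := hl a _ ha hne
  rw [hl0, eq_comm, sub_eq_zero, div_eq_div_iff hne ha, ← mul_right_inj' hC] at h
  have hnv : intVec n ⬝ᵥ v = v j := by rw [← hunit]; simp
  have hzero : 2 * Real.pi * I * v j * (riemannTheta τ a * riemannTheta τ a) = 0 := by
    rw [← hnv]
    linear_combination (-1 : ℂ) * h + riemannTheta τ a * hDn - riemannThetaDeriv τ v a * hθn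
  simpa [ha, Real.pi_ne_zero] using hzero
/-- The half-integer frequencies `m + ε / 2` of the theta function with characteristic `ε`. -/
def shiftedVec (ε m : Fin g → ℤ) : Fin g → ℂ := intVec m + (2 : ℂ)⁻¹ • intVec ε

lemma rapidDecay_gauss_shiftedVec (hτ : IsSiegel τ) (ε : Fin g → ℤ) :
    RapidDecay (shiftedVec ε) (fun m => gauss τ (shiftedVec ε m)) := by
  have h := rapidDecay_gauss hτ fun j => (ε j : ℝ) / 2
  have he : (fun m : Fin g → ℤ => intVec m + fun j => (((ε j : ℝ) / 2 : ℝ) : ℂ)) =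
      shiftedVec ε := by
    ext m j
    simp [shiftedVec, div_eq_inv_mul]
  rw [← he]
  exact h

lemma rapidDecay_theta (hτ : IsSiegel τ) (ε δ : Fin g → ℤ) :
    RapidDecay (shiftedVec ε) fun m => gauss τ (shiftedVec ε m) *
      cexp (2 * Real.pi * I * (shiftedVec ε m ⬝ᵥ (2 : ℂ)⁻¹ • intVec δ)) :=
  (rapidDecay_gauss_shiftedVec hτ ε).mul_of_le (C := 1) fun m => by
    rw [one_mul]
    exact norm_cexp_dotProduct_le _ _

lemma theta_eq_expSeries (τ : Matrix (Fin g) (Fin g) ℂ) (ε δ : Fin g → ℤ) :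
    theta τ ε δ = expSeries (shiftedVec ε) fun m => gauss τ (shiftedVec ε m) *
      cexp (2 * Real.pi * I * (shiftedVec ε m ⬝ᵥ (2 : ℂ)⁻¹ • intVec δ)) := by
  ext z
  refine tsum_congr fun m => ?_
  beta_reduce
  rw [gauss, ← Complex.exp_add, ← Complex.exp_add]
  have h1 : ∑ i, ∑ j, ((m i : ℂ) + (ε i : ℂ) / 2) * τ i j * ((m j : ℂ) + (ε j : ℂ) / 2) =
      shiftedVec ε m ⬝ᵥ τ *ᵥ shiftedVec ε m := by
    simp only [dotProduct, mulVec, Finset.mul_sum, shiftedVec, Pi.add_apply, Pi.smul_apply,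
      intVec_apply, smul_eq_mul]
    exact Finset.sum_congr rfl fun i _ => Finset.sum_congr rfl fun j _ => by ring
  have h2 : ∑ i, ((m i : ℂ) + (ε i : ℂ) / 2) * (z i + (δ i : ℂ) / 2) =
      shiftedVec ε m ⬝ᵥ z + shiftedVec ε m ⬝ᵥ (2 : ℂ)⁻¹ • intVec δ := by
    rw [← dotProduct_add]
    refine Finset.sum_congr rfl fun i _ => ?_
    simp only [shiftedVec, Pi.add_apply, Pi.smul_apply, intVec_apply, smul_eq_mul]
    ring
  rw [h1, h2]
  congr 1
  ring

lemma fderiv_theta_zero_apply (hτ : IsSiegel τ) (ε δ : Fin g → ℤ) (v : Fin g → ℂ) :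
    fderiv ℂ (theta τ ε δ) 0 v = ∑' m, gauss τ (shiftedVec ε m) *
      cexp (2 * Real.pi * I * (shiftedVec ε m ⬝ᵥ (2 : ℂ)⁻¹ • intVec δ)) *
        (2 * Real.pi * I * (shiftedVec ε m ⬝ᵥ v)) := by
  obtain ⟨L, hL, hLv⟩ := (rapidDecay_theta hτ ε δ).exists_hasFDerivAt 0
  rw [theta_eq_expSeries, hL.fderiv, hLv, expSeries]
  simp

lemma fderiv_theta_zero_apply_of_even (hτ : IsSiegel τ) {ε δ : Fin g → ℤ}
    (h : Even (∑ k, ε k * δ k)) (v : Fin g → ℂ) : fderiv ℂ (theta τ ε δ) 0 v = 0 := by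
  rw [fderiv_theta_zero_apply hτ, ← self_eq_neg]
  conv_lhs => rw [← (Equiv.subLeft (-ε)).tsum_eq]
  rw [← tsum_neg]
  refine tsum_congr fun m => ?_
  have hx : shiftedVec ε (Equiv.subLeft (-ε) m) = -shiftedVec ε m := by
    ext j
    simp only [shiftedVec, Equiv.subLeft_apply, Pi.add_apply, Pi.smul_apply, intVec_apply,
      Pi.sub_apply, Pi.neg_apply, smul_eq_mul]
    push_cast
    ring
  have hg : gauss τ (-shiftedVec ε m) = gauss τ (shiftedVec ε m) := by
    simp [gauss, mulVec_neg]
  have he : cexp (2 * Real.pi * I * (-shiftedVec ε m ⬝ᵥ (2 : ℂ)⁻¹ • intVec δ)) =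
      cexp (2 * Real.pi * I * (shiftedVec ε m ⬝ᵥ (2 : ℂ)⁻¹ • intVec δ)) := by
    obtain ⟨c, hc⟩ := h
    rw [Complex.exp_eq_exp_iff_exists_int]
    refine ⟨-(∑ k, m k * δ k + c), ?_⟩
    have hc' : intVec ε ⬝ᵥ intVec δ = (c : ℂ) + c := by
      have : intVec ε ⬝ᵥ intVec δ = ((∑ k, ε k * δ k : ℤ) : ℂ) := by simp [dotProduct]
      rw [this, hc]
      push_cast
      ring
    have hm : intVec m ⬝ᵥ intVec δ = ((∑ k, m k * δ k : ℤ) : ℂ) := by simp [dotProduct]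
    simp only [shiftedVec, neg_dotProduct, dotProduct_smul, add_dotProduct, smul_dotProduct,
      smul_eq_mul, hc', hm]
    push_cast
    ring
  rw [hx, hg, he, neg_dotProduct]
  ring

lemma tsum_gauss_eq_zero_of_fderiv_eq_zero (hτ : IsSiegel τ) {v : Fin g → ℂ}
    (hv : ∀ ε δ : Fin g → Fin 2, Odd (∑ k, ((ε k : ℕ) : ℤ) * ((δ k : ℕ) : ℤ)) →
      fderiv ℂ (theta τ (fun k => ((ε k : ℕ) : ℤ)) (fun k => ((δ k : ℕ) : ℤ))) 0 v = 0)
    (r : Fin g → ℤ) :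
    ∑' k : Fin g → ℤ, gauss τ ((2 : ℂ)⁻¹ • (intVec r + (4 : ℂ) • intVec k)) *
      ((intVec r + (4 : ℂ) • intVec k) ⬝ᵥ v) = 0 := by
  set q : Fin g → ℤ := fun j => r j / 2
  obtain ⟨e, he⟩ : ∃ e : Fin g → Fin 2, ∀ j, ((e j : ℕ) : ℤ) = r j % 2 :=
    ⟨fun j => ⟨(r j % 2).toNat, by omega⟩, fun j => by simp only; omega⟩
  set ε : Fin g → ℤ := fun j => ((e j : ℕ) : ℤ)
  set A : (Fin g → ℤ) → ℂ := fun m =>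
    gauss τ (shiftedVec ε m) * (2 * Real.pi * I * (shiftedVec ε m ⬝ᵥ v)) with hA
  have hsum : Summable fun m => ‖A m‖ := by
    simpa only [dotProduct_zero, mul_zero, Complex.exp_zero, mul_one] using
      ((rapidDecay_gauss_shiftedVec hτ ε).mul_dotProduct v).summable_norm 0
  have hfourier : ∀ x : Fin g → Fin 2,
      ∑' m, A m * cexp (2 * Real.pi * I * (intVec m ⬝ᵥ fun j => ((x j : ℕ) : ℂ) / (2 : ℕ))) =
        0 := fun x => by
    have hzero : fderiv ℂ (theta τ ε fun k => ((x k : ℕ) : ℤ)) 0 v = 0 := by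
      rcases Int.even_or_odd (∑ k, ε k * ((x k : ℕ) : ℤ)) with h | h
      · exact fderiv_theta_zero_apply_of_even hτ h v
      · exact hv e x h
    rw [fderiv_theta_zero_apply hτ] at hzero
    set y : Fin g → ℂ := (2 : ℂ)⁻¹ • intVec fun k => ((x k : ℕ) : ℤ)
    have hy : (fun j => ((x j : ℕ) : ℂ) / (2 : ℕ)) = y := by
      ext j
      simp [y, div_eq_inv_mul]
    rw [hy]
    refine Eq.trans (tsum_congr fun m => ?_) ((tsum_mul_left
      (a := cexp (-(2 * Real.pi * I * ((2 : ℂ)⁻¹ • intVec ε ⬝ᵥ y))))).trans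
      (by rw [hzero, mul_zero]))
    have hexp : cexp (2 * Real.pi * I * (intVec m ⬝ᵥ y)) =
        cexp (-(2 * Real.pi * I * ((2 : ℂ)⁻¹ • intVec ε ⬝ᵥ y))) *
          cexp (2 * Real.pi * I * (shiftedVec ε m ⬝ᵥ y)) := by
      rw [← Complex.exp_add, shiftedVec, add_dotProduct]
      congr 1
      ring
    rw [hexp, hA]
    ring
  have hclass := tsum_residue_class_eq_zero hsum 2 hfourier q
  have hinj : Function.Injective fun k : Fin g → ℤ => q + 2 * k := fun k k' h => by
    ext j
    have := congrFun h j
    simpa using this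
  rw [← hinj.tsum_eq] at hclass
  · refine Eq.trans (tsum_congr fun k => ?_)
      ((tsum_mul_left (a := (Real.pi * I : ℂ)⁻¹)).trans (by rw [hclass, mul_zero]))
    have hdvd : ∀ j, ((2 : ℕ) : ℤ) ∣ (q + 2 * k) j - q j := fun j => ⟨k j, by simp⟩
    have hx : shiftedVec ε (q + 2 * k) = (2 : ℂ)⁻¹ • (intVec r + (4 : ℂ) • intVec k) := by
      ext j
      have hr : (r j : ℂ) = 2 * (q j : ℂ) + (ε j : ℂ) := by
        have : r j = 2 * q j + ε j := by
          simp only [q, ε, he]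
          omega
        exact_mod_cast this
      simp only [shiftedVec, Pi.add_apply, Pi.smul_apply, intVec_apply, smul_eq_mul, Pi.mul_apply,
        Pi.ofNat_apply, hr]
      push_cast
      ring
    rw [if_pos hdvd, hA]
    simp only [hx, smul_dotProduct, smul_eq_mul]
    have hpi : (Real.pi : ℂ) ≠ 0 := by exact_mod_cast Real.pi_ne_zero
    have hI := Complex.I_ne_zero
    field_simp
  · intro m hm
    have hdvd : ∀ j, ((2 : ℕ) : ℤ) ∣ m j - q j := by
      by_contra h
      exact hm (if_neg h)
    choose k hk using hdvd
    refine ⟨k, ?_⟩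
    ext j
    have := hk j
    simp only [Pi.add_apply, Pi.mul_apply, Pi.ofNat_apply]
    push_cast at this
    omega

end Span

end ThetaGradients

theorem statement14 {g : ℕ} (hg : 1 ≤ g) (τ : Matrix (Fin g) (Fin g) ℂ)
    (hτ : IsSiegel τ) :
    Submodule.span ℂ
        {v : Fin g → ℂ | ∃ ε δ : Fin g → Fin 2,
          Odd (∑ k, ((ε k : ℕ) : ℤ) * ((δ k : ℕ) : ℤ)) ∧
          v = fun i =>
            fderiv ℂ (theta τ (fun k => ((ε k : ℕ) : ℤ)) (fun k => ((δ k : ℕ) : ℤ))) 0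
              (Pi.single i 1)} = ⊤ := by
  by_contra hspan
  obtain ⟨f, hf, hker⟩ := Submodule.exists_le_ker_of_lt_top _ (lt_top_iff_ne_top.mpr hspan)
  have hfv : ∀ w : Fin g → ℂ, f w = ∑ i, f (Pi.single i 1) * w i := fun w => by
    rw [f.pi_apply_eq_sum_univ w]
    refine Finset.sum_congr rfl fun i _ => ?_
    rw [smul_eq_mul, mul_comm]
    congr 2
    ext j
    simp [Pi.single_apply, eq_comm]
  refine hf (LinearMap.ext fun w => ?_)
  rw [hfv]
  have hv : (fun i => f (Pi.single i 1)) = 0 := by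
    refine eq_zero_of_tsum_gauss_eq_zero hτ (tsum_gauss_eq_zero_of_fderiv_eq_zero hτ ?_)
    intro ε δ hodd
    set L := fderiv ℂ (theta τ (fun k => ((ε k : ℕ) : ℤ)) (fun k => ((δ k : ℕ) : ℤ))) 0
    have h0 : f (fun i => L (Pi.single i 1)) = 0 :=
      hker (Submodule.subset_span ⟨ε, δ, hodd, rfl⟩)
    rw [hfv] at h0
    rw [← h0, ← ContinuousLinearMap.coe_coe, LinearMap.pi_apply_eq_sum_univ]
    refine Finset.sum_congr rfl fun i _ => ?_
    rw [smul_eq_mul, ContinuousLinearMap.coe_coe]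
    congr 2
    ext j
    simp [Pi.single_apply, eq_comm]
  exact Finset.sum_eq_zero fun i _ => by rw [show f (Pi.single i 1) = 0 from congrFun hv i, zero_mul]
end
end
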